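/- arXiv:2211.03503 — 2 statements merged into one kernel-verified Lean document; each statement's English description precedes it below -/
import Mathlib

section
/- Corollary: Let (X,f) have the shadowing property and let Y ⊆ X be an isolated chain recurrent class (i.e., for some ε > 0, B(Y,ε) ∩ CR(f) = Y), and Φ continuous with two ergodic measures on Y having distinct Φ-averages. Then h_{I_Φ(f) ∩ Y}(f) = h_Y(f), and the lower and upper relative metric mean dimensions of I_Φ(f) ∩ Y equal those of Y. -/
open Filter Topology MeasureTheory Set
open scoped ENNReal NNReal

variable {X : Type*} [MetricSpace X]

/-- `x` is in the chain stable set of `y` at scale `ε`: there is a finite sequence of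
points starting at `x`, ending at `y`, and positive iteration times `t i` with
`d(f^[t i] (x i), x (i+1)) < ε`. -/
def ChainStable (f : X → X) (ε : ℝ) (x y : X) : Prop :=
  ∃ (n : ℕ) (c : ℕ → X) (t : ℕ → ℕ), 1 ≤ n ∧ c 0 = x ∧ c n = y ∧
    ∀ i < n, 1 ≤ t i ∧ dist (f^[t i] (c i)) (c (i + 1)) < ε

/-- `x` and `y` are chain related: each is in the chain stable set of the other for every `ε > 0`. -/
def ChainRelated (f : X → X) (x y : X) : Prop :=
  ∀ ε : ℝ, 0 < ε → ChainStable f ε x y ∧ ChainStable f ε y x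

/-- The set of chain recurrent points. -/
def ChainRecurrent (f : X → X) : Set X := {x | ChainRelated f x x}

/-- The chain recurrent class of a point `y`. -/
def ChainClassOf (f : X → X) (y : X) : Set X :=
  {x ∈ ChainRecurrent f | ChainRelated f x y}

/-- `Y` is a chain recurrent class. -/
def IsChainClass (f : X → X) (Y : Set X) : Prop :=
  ∃ y ∈ ChainRecurrent f, Y = ChainClassOf f y

/-- `x` is a nonwandering point of `f`. -/
def NonWandering (f : X → X) (x : X) : Prop :=
  ∀ U : Set X, IsOpen U → x ∈ U → ∃ k : ℕ, 1 ≤ k ∧ (f^[k] '' U ∩ U).Nonempty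

/-- `f` has the shadowing property. -/
def ShadowingProperty (f : X → X) : Prop :=
  ∀ ε : ℝ, 0 < ε → ∃ δ : ℝ, 0 < δ ∧ ∀ z : ℕ → X,
    (∀ n, dist (f (z n)) (z (n + 1)) < δ) → ∃ y : X, ∀ n, dist (f^[n] y) (z n) < ε

/-- `q` is a minimal point: its orbit closure is a minimal set. -/
def MinimalPoint (f : X → X) (q : X) : Prop :=
  ∀ p ∈ closure (Set.range fun n => f^[n] q),
    closure (Set.range fun n => f^[n] p) = closure (Set.range fun n => f^[n] q)

/-- The `(n,ε)`-Bowen ball around `x`. -/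
def bowenBall (f : X → X) (n : ℕ) (x : X) (ε : ℝ) : Set X :=
  {y | ∀ i < n, dist (f^[i] x) (f^[i] y) < ε}

/-- `C(Z,t,n,ε,f)`: infimum over countable covers of `Z` by Bowen balls `B_v(x,ε)`, `v ≥ n`,
of `Σ e^{-t v}`. -/
noncomputable def bowenC (f : X → X) (Z : Set X) (t ε : ℝ) (n : ℕ) : ℝ≥0∞ :=
  ⨅ (c : ℕ → X) (v : ℕ → ℕ) (_ : ∀ i, n ≤ v i)
    (_ : Z ⊆ ⋃ i, bowenBall f (v i) (c i) ε),
    ∑' i, ENNReal.ofReal (Real.exp (-t * v i))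

/-- `C(Z,t,ε,f) = lim_{n→∞} C(Z,t,n,ε,f)` (the limit is a supremum by monotonicity). -/
noncomputable def bowenCLim (f : X → X) (Z : Set X) (t ε : ℝ) : ℝ≥0∞ :=
  ⨆ n, bowenC f Z t ε n

/-- Bowen entropy of `Z` at scale `ε`: `inf {t : C(Z,t,ε,f) = 0}`, valued in `[0,∞]`. -/
noncomputable def bowenH (f : X → X) (Z : Set X) (ε : ℝ) : ℝ≥0∞ :=
  sInf (ENNReal.ofReal '' {t : ℝ | bowenCLim f Z t ε = 0})

/-- Bowen topological entropy of `Z`: `lim_{ε→0} h_Z(f,ε)`, a supremum by monotonicity. -/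
noncomputable def bowenEntropy (f : X → X) (Z : Set X) : ℝ≥0∞ :=
  ⨆ (ε : ℝ) (_ : 0 < ε), bowenH f Z ε

/-- Upper relative metric mean dimension of `Z`: `limsup_{ε→0⁺} h_Z(f,ε)/(-log ε)`. -/
noncomputable def upperMdim (f : X → X) (Z : Set X) : ℝ≥0∞ :=
  Filter.limsup (fun ε : ℝ => bowenH f Z ε / ENNReal.ofReal (-Real.log ε))
    (nhdsWithin 0 (Set.Ioi 0))

/-- Lower relative metric mean dimension of `Z`: `liminf_{ε→0⁺} h_Z(f,ε)/(-log ε)`. -/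
noncomputable def lowerMdim (f : X → X) (Z : Set X) : ℝ≥0∞ :=
  Filter.liminf (fun ε : ℝ => bowenH f Z ε / ENNReal.ofReal (-Real.log ε))
    (nhdsWithin 0 (Set.Ioi 0))

/-- Birkhoff average `(1/n) Σ_{i<n} Φ(f^i x)`. -/
noncomputable def birkhoffAvg (f : X → X) (Φ : X → ℝ) (n : ℕ) (x : X) : ℝ :=
  (1 / (n : ℝ)) * ∑ i ∈ Finset.range n, Φ (f^[i] x)

/-- The `Φ`-irregular set: points where the Birkhoff averages of `Φ` diverge. -/
def IrregularSet (f : X → X) (Φ : X → ℝ) : Set X :=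
  {x | ¬ ∃ L : ℝ, Tendsto (fun n => birkhoffAvg f Φ n x) atTop (nhds L)}


/-- Unit-step `δ`-chain of length `n` from `x` to `y`. -/
def PChain (f : X → X) (δ : ℝ) (n : ℕ) (x y : X) : Prop :=
  ∃ z : ℕ → X, z 0 = x ∧ z n = y ∧ ∀ i < n, dist (f (z i)) (z (i + 1)) < δ

/-- `y` can be reached from `x` at every scale. -/
def Conn (f : X → X) (x y : X) : Prop :=
  ∀ δ : ℝ, 0 < δ → ∃ n, 1 ≤ n ∧ PChain f δ n x y

/-- Concatenation of two finite sequences. -/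
def catSeq (n : ℕ) (z w : ℕ → X) : ℕ → X := fun i => if i < n then z i else w (i - n)

theorem catSeq_lt {n : ℕ} {z w : ℕ → X} {i : ℕ} (h : i < n) : catSeq n z w i = z i := by
  simp [catSeq, h]

theorem catSeq_add {n : ℕ} {z w : ℕ → X} (i : ℕ) : catSeq n z w (n + i) = w i := by
  simp [catSeq]

theorem catSeq_le {n : ℕ} {z w : ℕ → X} (hzw : z n = w 0) {i : ℕ} (h : i ≤ n) :
    catSeq n z w i = z i := by
  rcases h.lt_or_eq with h | h
  · exact catSeq_lt h
  · subst h
    have := catSeq_add (n := i) (z := z) (w := w) 0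
    simpa [hzw] using this

theorem catSeq_chain {f : X → X} {δ : ℝ} {n m : ℕ} {z w : ℕ → X} (hzw : z n = w 0)
    (hz : ∀ i < n, dist (f (z i)) (z (i + 1)) < δ)
    (hw : ∀ i < m, dist (f (w i)) (w (i + 1)) < δ) :
    ∀ i < n + m, dist (f (catSeq n z w i)) (catSeq n z w (i + 1)) < δ := by
  intro i hi
  rcases lt_or_ge i n with h | h
  · rw [catSeq_le hzw h.le, catSeq_le hzw h]
    exact hz i h
  · obtain ⟨k, rfl⟩ := Nat.exists_eq_add_of_le h
    rw [add_assoc, catSeq_add, catSeq_add]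
    exact hw k (by omega)

theorem PChain.trans {f : X → X} {δ : ℝ} {n m : ℕ} {x y w : X}
    (h1 : PChain f δ n x y) (h2 : PChain f δ m y w) : PChain f δ (n + m) x w := by
  obtain ⟨z, z0, zn, hz⟩ := h1
  obtain ⟨u, u0, um, hu⟩ := h2
  have hzu : z n = u 0 := by rw [zn, u0]
  refine ⟨catSeq n z u, ?_, ?_, catSeq_chain hzu hz hu⟩
  · rw [catSeq_le hzu (Nat.zero_le _), z0]
  · rw [catSeq_add, um]

theorem pchain_orbit {f : X → X} {δ : ℝ} {t : ℕ} {x y : X} (ht : 1 ≤ t)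
    (h : dist (f^[t] x) y < δ) : PChain f δ t x y := by
  have hδ : 0 < δ := lt_of_le_of_lt dist_nonneg h
  refine ⟨fun i => if i < t then f^[i] x else y, ?_, by simp, ?_⟩
  · simp [show 0 < t by omega]
  · intro i hi
    simp only [hi, if_true]
    split_ifs with h2
    · rw [Function.iterate_succ_apply', dist_self]; exact hδ
    · have : t = i + 1 := by omega
      rw [this, Function.iterate_succ_apply'] at h
      exact h

theorem ChainStable.pchain {f : X → X} {ε : ℝ} {x y : X} (h : ChainStable f ε x y) :
    ∃ n, 1 ≤ n ∧ PChain f ε n x y := by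
  obtain ⟨n, c, t, hn, h0, hc, hs⟩ := h
  have key : ∀ k, 1 ≤ k → k ≤ n → ∃ m, 1 ≤ m ∧ PChain f ε m (c 0) (c k) := by
    intro k hk
    induction k, hk using Nat.le_induction with
    | base =>
      intro h
      obtain ⟨h1, h2⟩ := hs 0 (by omega)
      exact ⟨t 0, h1, pchain_orbit h1 h2⟩
    | succ k hk ih =>
      intro h
      obtain ⟨m, hm, hch⟩ := ih (by omega)
      obtain ⟨h1, h2⟩ := hs k (by omega)
      exact ⟨m + t k, by omega, hch.trans (pchain_orbit h1 h2)⟩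
  obtain ⟨m, hm, h⟩ := key n hn le_rfl
  exact ⟨m, hm, by rw [← h0, ← hc]; exact h⟩

theorem PChain.chainStable {f : X → X} {ε : ℝ} {x y : X} {n : ℕ} (hn : 1 ≤ n)
    (h : PChain f ε n x y) : ChainStable f ε x y := by
  obtain ⟨z, z0, zn, hz⟩ := h
  exact ⟨n, z, fun _ => 1, hn, z0, zn, fun i hi => ⟨le_rfl, by simpa using hz i hi⟩⟩

theorem chainRelated_iff {f : X → X} {x y : X} :
    ChainRelated f x y ↔ Conn f x y ∧ Conn f y x := by
  constructor
  · intro h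
    exact ⟨fun δ hδ => (h δ hδ).1.pchain, fun δ hδ => (h δ hδ).2.pchain⟩
  · rintro ⟨h1, h2⟩ δ hδ
    obtain ⟨n, hn, hc⟩ := h1 δ hδ
    obtain ⟨m, hm, hd⟩ := h2 δ hδ
    exact ⟨hc.chainStable hn, hd.chainStable hm⟩

theorem Conn.trans {f : X → X} {x y z : X} (h1 : Conn f x y) (h2 : Conn f y z) : Conn f x z := by
  intro δ hδ
  obtain ⟨n, hn, hc⟩ := h1 δ hδ
  obtain ⟨m, hm, hd⟩ := h2 δ hδ
  exact ⟨n + m, by omega, hc.trans hd⟩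

theorem mem_chainRecurrent_iff {f : X → X} {x : X} : x ∈ ChainRecurrent f ↔ Conn f x x := by
  simp [ChainRecurrent, chainRelated_iff]

theorem mem_chainClassOf_iff {f : X → X} {x y : X} :
    x ∈ ChainClassOf f y ↔ Conn f x y ∧ Conn f y x := by
  simp only [ChainClassOf, Set.mem_sep_iff, mem_chainRecurrent_iff, chainRelated_iff]
  exact ⟨fun h => h.2, fun h => ⟨h.1.trans h.2, h⟩⟩

theorem pchain_perturb [CompactSpace X] {f : X → X} (hf : Continuous f) {δ : ℝ} (hδ : 0 < δ) :
    ∃ ρ : ℝ, 0 < ρ ∧ ∀ x x' : X, dist x x' < ρ → ∀ n, 1 ≤ n → ∀ y,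
      (PChain f (δ / 2) n x' y → PChain f δ n x y) ∧
      (PChain f (δ / 2) n y x' → PChain f δ n y x) := by
  have huc := CompactSpace.uniformContinuous_of_continuous hf
  obtain ⟨ρ, hρ, hρ2⟩ := Metric.uniformContinuous_iff.1 huc (δ / 2) (by linarith)
  refine ⟨min ρ (δ / 2), by positivity, ?_⟩
  intro x x' hxx n hn y
  have hx1 : dist (f x) (f x') < δ / 2 := hρ2 (lt_of_lt_of_le hxx (min_le_left _ _))
  have hx2 : dist x x' < δ / 2 := lt_of_lt_of_le hxx (min_le_right _ _)
  constructor
  · rintro ⟨z, z0, zn, hz⟩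
    refine ⟨fun i => if i = 0 then x else z i, by simp, by simp [show n ≠ 0 by omega, zn], ?_⟩
    intro i hi
    have h3 := hz i hi
    rcases Nat.eq_zero_or_pos i with h | h
    · subst h
      rw [z0] at h3
      have := dist_triangle (f x) (f x') (z (0 + 1))
      simp only [if_true]
      simp at this h3 ⊢
      linarith
    · simp [show i ≠ 0 by omega]; linarith
  · rintro ⟨z, z0, zn, hz⟩
    refine ⟨fun i => if i = n then x else z i, by simp [show 0 ≠ n by omega, z0], by simp, ?_⟩
    intro i hi
    have h3 := hz i hi
    rcases eq_or_ne (i + 1) n with h | h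
    · rw [h, zn] at h3
      have := dist_triangle (f (z i)) x' x
      rw [dist_comm x' x] at this
      simp only [h, hi.ne, if_true, if_false]
      linarith
    · simp only [h, hi.ne, if_false]; linarith

theorem isClosed_conn_to [CompactSpace X] {f : X → X} (hf : Continuous f) (y : X) :
    IsClosed {x | Conn f x y} := by
  rw [← closure_subset_iff_isClosed]
  intro x hx δ hδ
  obtain ⟨ρ, hρ, h⟩ := pchain_perturb hf hδ
  obtain ⟨x', hx', hd⟩ := Metric.mem_closure_iff.1 hx ρ hρ
  obtain ⟨n, hn, hc⟩ := hx' (δ / 2) (by linarith)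
  exact ⟨n, hn, (h x x' hd n hn y).1 hc⟩

theorem isClosed_conn_from [CompactSpace X] {f : X → X} (hf : Continuous f) (y : X) :
    IsClosed {x | Conn f y x} := by
  rw [← closure_subset_iff_isClosed]
  intro x hx δ hδ
  obtain ⟨ρ, hρ, h⟩ := pchain_perturb hf hδ
  obtain ⟨x', hx', hd⟩ := Metric.mem_closure_iff.1 hx ρ hρ
  obtain ⟨n, hn, hc⟩ := hx' (δ / 2) (by linarith)
  exact ⟨n, hn, (h x x' hd n hn y).2 hc⟩

theorem isClosed_chainClassOf [CompactSpace X] {f : X → X} (hf : Continuous f) (y : X) :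
    IsClosed (ChainClassOf f y) := by
  have : ChainClassOf f y = {x | Conn f x y} ∩ {x | Conn f y x} := by
    ext x; exact mem_chainClassOf_iff
  rw [this]
  exact (isClosed_conn_to hf y).inter (isClosed_conn_from hf y)

theorem conn_apply {f : X → X} (x : X) : Conn f x (f x) := fun δ hδ =>
  ⟨1, le_rfl, pchain_orbit le_rfl (by simpa using hδ)⟩

theorem conn_map_to [CompactSpace X] {f : X → X} (hf : Continuous f) {x y : X} (h : Conn f x y)
    (hy : Conn f y y) : Conn f (f x) y := by
  intro δ hδ
  have huc := CompactSpace.uniformContinuous_of_continuous hf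
  obtain ⟨ρ, hρ, hρ2⟩ := Metric.uniformContinuous_iff.1 huc (δ / 2) (by linarith)
  set δ' := min ρ (δ / 2)
  have hδ' : 0 < δ' := by positivity
  obtain ⟨n, hn, hc⟩ := h δ' hδ'
  obtain ⟨m, hm, hd⟩ := hy δ' hδ'
  obtain ⟨z, z0, zn, hz⟩ := hc.trans hd
  refine ⟨n + m - 1, by omega, fun i => if i = 0 then f x else z (i + 1), by simp, ?_, ?_⟩
  · simp only [show n + m - 1 ≠ 0 by omega, if_false]
    rw [show n + m - 1 + 1 = n + m by omega, zn]
  · intro i hi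
    have h3 := hz (i + 1) (by omega)
    rcases Nat.eq_zero_or_pos i with h | h
    · subst h
      have h4 := hz 0 (by omega)
      rw [z0] at h4
      have h5 := hρ2 (lt_of_lt_of_le h4 (min_le_left _ _))
      have := dist_triangle (f (f x)) (f (z (0 + 1))) (z (0 + 1 + 1))
      have h6 : δ' ≤ δ / 2 := min_le_right _ _
      simp at this h3 h5 ⊢
      linarith
    · have h6 : δ' ≤ δ / 2 := min_le_right _ _
      simp only [show i ≠ 0 by omega, if_false, show i + 1 ≠ 0 by omega]
      linarith

theorem chainClassOf_map [CompactSpace X] {f : X → X} (hf : Continuous f) {x y : X}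
    (hx : x ∈ ChainClassOf f y) : f x ∈ ChainClassOf f y := by
  rw [mem_chainClassOf_iff] at *
  exact ⟨conn_map_to hf hx.1 (hx.2.trans hx.1), hx.2.trans (conn_apply x)⟩

theorem chainClassOf_iterate [CompactSpace X] {f : X → X} (hf : Continuous f) {x y : X}
    (hx : x ∈ ChainClassOf f y) (n : ℕ) : f^[n] x ∈ ChainClassOf f y := by
  induction n with
  | zero => exact hx
  | succ n ih => rw [Function.iterate_succ_apply']; exact chainClassOf_map hf ih

/-- limits along orbits are chain recurrent -/
theorem chainRecurrent_of_limit {f : X → X} (hf : Continuous f) {u y : X} {φ : ℕ → ℕ}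
    (hφ : StrictMono φ) (h : Tendsto (fun k => f^[φ k] u) atTop (𝓝 y)) :
    y ∈ ChainRecurrent f := by
  rw [mem_chainRecurrent_iff]
  intro δ hδ
  have h1 : ∀ᶠ k in atTop, dist (f^[φ k] u) y < δ := Metric.tendsto_nhds.1 h δ hδ
  have h2 : ∀ᶠ k in atTop, dist (f (f^[φ k] u)) (f y) < δ :=
    Metric.tendsto_nhds.1 ((hf.tendsto y).comp h) δ hδ
  obtain ⟨K, hK⟩ := eventually_atTop.1 (h1.and h2)
  have hlt : φ K + 1 < φ (K + 2) := by
    have a := hφ (show K < K + 1 by omega)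
    have b := hφ (show K + 1 < K + 2 by omega)
    omega
  have c1 : PChain f δ 1 y (f (f^[φ K] u)) := pchain_orbit le_rfl (by
    rw [dist_comm]; exact (hK K le_rfl).2)
  have c2 : PChain f δ (φ (K + 2) - (φ K + 1)) (f (f^[φ K] u)) y := pchain_orbit (by omega) (by
    rw [← Function.iterate_succ_apply' f, ← Function.iterate_add_apply]
    have e : φ (K + 2) - (φ K + 1) + (φ K).succ = φ (K + 2) := by omega
    rw [e]
    exact (hK (K + 2) (by omega)).1)
  exact ⟨_, by omega, c1.trans c2⟩

theorem isClosed_chainRecurrent [CompactSpace X] {f : X → X} (hf : Continuous f) :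
    IsClosed (ChainRecurrent f) := by
  rw [← closure_subset_iff_isClosed]
  intro x hx
  rw [mem_chainRecurrent_iff]
  intro δ hδ
  obtain ⟨ρ, hρ, h⟩ := pchain_perturb hf hδ
  obtain ⟨ρ', hρ', h'⟩ := pchain_perturb hf (half_pos hδ)
  obtain ⟨x', hx', hd⟩ := Metric.mem_closure_iff.1 hx (min ρ ρ') (by positivity)
  obtain ⟨n, hn, hc⟩ := (mem_chainRecurrent_iff.1 hx') (δ / 2 / 2) (by linarith)
  exact ⟨n, hn, (h x x' (lt_of_lt_of_le hd (min_le_left _ _)) n hn x).1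
    ((h' x x' (lt_of_lt_of_le hd (min_le_right _ _)) n hn x').2 hc)⟩

/-- Shadowing inside an isolated class, for pseudo-orbits returning to a base point at
all multiples of `P`. -/
theorem class_shadowing [CompactSpace X] {f : X → X} (hf : Continuous f)
    (hsh : ShadowingProperty f) {Y : Set X} {r : ℝ} (hr : 0 < r)
    (hiso : Metric.thickening r Y ∩ ChainRecurrent f = Y) {p : X} (hp : p ∈ Y)
    {ε : ℝ} (hε : 0 < ε) :
    ∃ δ : ℝ, 0 < δ ∧ ∀ (z : ℕ → X) (P : ℕ), 1 ≤ P → (∀ Q, z (Q * P) = p) →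
      (∀ n, dist (f (z n)) (z (n + 1)) < δ) → ∃ v ∈ Y, ∀ n, dist (f^[n] v) (z n) < ε := by
  set η := min ε r / 2 with hη
  have hη0 : 0 < η := by positivity
  have hηε : η < ε := by
    have : min ε r ≤ ε := min_le_left _ _
    linarith
  have hηr : η < r := by
    have : min ε r ≤ r := min_le_right _ _
    linarith
  obtain ⟨δ, hδ, hs⟩ := hsh η hη0
  refine ⟨δ, hδ, ?_⟩
  intro z P hP hzp hz
  have hz0 : z 0 = p := by simpa using hzp 0
  have step : ∀ Q : ℕ, ∃ y ∈ ChainRecurrent f, ∀ t < (Q + 1) * P, dist (f^[t] y) (z t) ≤ η := by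
    intro Q
    set N := (Q + 1) * P with hN
    have hN0 : 0 < N := by positivity
    obtain ⟨u, hu⟩ := hs (fun t => z (t % N)) (by
      intro t
      have hlt := Nat.mod_lt t hN0
      rcases (Nat.lt_or_ge (t % N + 1) N) with h | h
      · have : (t + 1) % N = t % N + 1 := by
          rw [Nat.add_mod, Nat.mod_eq_of_lt (show 1 < N by omega), Nat.mod_eq_of_lt h]
        simp only [this]
        exact hz _
      · have e : t % N + 1 = N := by omega
        have : (t + 1) % N = 0 := by
          rw [← Nat.mod_add_mod, e, Nat.mod_self]
        simp only [this]
        have h2 := hz (t % N)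
        rw [e, hN, hzp] at h2
        rw [hz0]
        exact h2)
    obtain ⟨y, φ, hφ, hy⟩ := CompactSpace.tendsto_subseq (fun k => f^[k * N] u)
    refine ⟨y, ?_, ?_⟩
    · refine chainRecurrent_of_limit hf (φ := fun k => φ k * N) ?_ hy
      intro a b hab
      exact Nat.mul_lt_mul_of_pos_right (hφ hab) hN0
    · intro t ht
      have hc : Tendsto (fun k => dist (f^[t] (f^[φ k * N] u)) (z t)) atTop
          (𝓝 (dist (f^[t] y) (z t))) :=
        (((hf.iterate t).tendsto y).comp hy).dist tendsto_const_nhds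
      refine le_of_tendsto hc (Eventually.of_forall fun k => ?_)
      rw [← Function.iterate_add_apply]
      have := hu (t + φ k * N)
      rw [Nat.add_mul_mod_self_right, Nat.mod_eq_of_lt ht] at this
      exact this.le
  choose y hyc hyd using step
  obtain ⟨v, φ, hφ, hv⟩ := CompactSpace.tendsto_subseq y
  have hvd : ∀ t, dist (f^[t] v) (z t) ≤ η := by
    intro t
    have hc : Tendsto (fun k => dist (f^[t] (y (φ k))) (z t)) atTop
        (𝓝 (dist (f^[t] v) (z t))) :=
      (((hf.iterate t).tendsto v).comp hv).dist tendsto_const_nhds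
    refine le_of_tendsto hc ?_
    filter_upwards [eventually_ge_atTop t] with k hk
    refine hyd _ _ ?_
    have : k ≤ φ k := hφ.id_le k
    calc t < φ k + 1 := by omega
      _ ≤ (φ k + 1) * P := Nat.le_mul_of_pos_right _ hP
  have hvc : v ∈ ChainRecurrent f :=
    (isClosed_chainRecurrent hf).mem_of_tendsto hv (Eventually.of_forall fun k => hyc _)
  refine ⟨v, ?_, fun n => (hvd n).trans_lt hηε⟩
  rw [← hiso]
  refine ⟨Metric.mem_thickening_iff.2 ⟨p, hp, ?_⟩, hvc⟩
  have := hvd 0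
  rw [hz0] at this
  exact lt_of_le_of_lt this hηr

/-- Uniform bound for connecting times with a base point. -/
theorem uniform_connect [CompactSpace X] {f : X → X} (hf : Continuous f) (p : X)
    {δ : ℝ} (hδ : 0 < δ) :
    ∃ M : ℕ, ∀ x ∈ ChainClassOf f p, (∃ a ≤ M, PChain f δ a p x) ∧ (∃ b ≤ M, PChain f δ b x p) := by
  obtain ⟨ρ, hρ, h⟩ := pchain_perturb hf hδ
  obtain ⟨s, hsY, hsf, hcov⟩ := Metric.finite_approx_of_totallyBounded
    ((isClosed_chainClassOf hf p).isCompact.totallyBounded) ρ hρ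
  have h1 : ∀ x ∈ s, ∃ a, 1 ≤ a ∧ PChain f (δ / 2) a p x := fun x hx =>
    (mem_chainClassOf_iff.1 (hsY hx)).2 _ (by linarith)
  have h2 : ∀ x ∈ s, ∃ a, 1 ≤ a ∧ PChain f (δ / 2) a x p := fun x hx =>
    (mem_chainClassOf_iff.1 (hsY hx)).1 _ (by linarith)
  choose! a ha1 ha using h1
  choose! b hb1 hb using h2
  obtain ⟨A, hA⟩ := (hsf.image a).bddAbove
  obtain ⟨B, hB⟩ := (hsf.image b).bddAbove
  refine ⟨max A B, fun x hx => ?_⟩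
  obtain ⟨x', hx', hd⟩ := Set.mem_iUnion₂.1 (hcov hx)
  rw [Metric.mem_ball] at hd
  exact ⟨⟨a x', le_max_of_le_left (hA ⟨x', hx', rfl⟩), (h x x' hd _ (ha1 _ hx') p).2 (ha _ hx')⟩,
    ⟨b x', le_max_of_le_right (hB ⟨x', hx', rfl⟩), (h x x' hd _ (hb1 _ hx') p).1 (hb _ hx')⟩⟩

/-- Loops at `p` containing a prescribed orbit segment. -/
theorem exists_loop [CompactSpace X] {f : X → X} (hf : Continuous f) (p : X)
    {δ : ℝ} (hδ : 0 < δ) :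
    ∃ M : ℕ, ∀ x ∈ ChainClassOf f p, ∀ n : ℕ, ∃ (a L : ℕ) (z : ℕ → X), a ≤ M ∧ a + n ≤ L ∧
      L ≤ n + 2 * M ∧ z 0 = p ∧ z L = p ∧ (∀ i < L, dist (f (z i)) (z (i + 1)) < δ) ∧
      ∀ i < n, z (a + i) = f^[i] x := by
  obtain ⟨M, hM⟩ := uniform_connect hf p hδ
  refine ⟨M, fun x hx n => ?_⟩
  obtain ⟨a, haM, z, z0, za, hz⟩ := (hM x hx).1
  obtain ⟨b, hbM, w, w0, wb, hw⟩ := (hM _ (chainClassOf_iterate hf hx n)).2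
  have e1 : (fun i => f^[i] x) n = w 0 := by simp [w0]
  have e2 : z a = catSeq n (fun i => f^[i] x) w 0 := by
    rw [catSeq_le e1 (Nat.zero_le _), za]; rfl
  refine ⟨a, a + (n + b), catSeq a z (catSeq n (fun i => f^[i] x) w), haM, by omega, by omega,
    ?_, ?_, ?_, ?_⟩
  · rw [catSeq_le e2 (Nat.zero_le _), z0]
  · rw [catSeq_add, catSeq_add, wb]
  · refine catSeq_chain e2 hz (catSeq_chain e1 ?_ hw)
    intro i _
    simp only [Function.iterate_succ_apply', dist_self]
    exact hδ
  · intro i hi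
    rw [catSeq_add, catSeq_lt hi]


theorem bowenC_mono_n (f : X → X) (Z : Set X) (t ε : ℝ) {n m : ℕ} (h : n ≤ m) :
    bowenC f Z t ε n ≤ bowenC f Z t ε m := by
  unfold bowenC
  refine le_iInf fun c => le_iInf fun v => le_iInf fun hv => le_iInf fun hc => ?_
  exact iInf_le_of_le c (iInf_le_of_le v (iInf_le_of_le (fun i => h.trans (hv i))
    (iInf_le_of_le hc le_rfl)))

theorem bowenC_mono_set (f : X → X) {Z W : Set X} (hZW : Z ⊆ W) (t ε : ℝ) (n : ℕ) :
    bowenC f Z t ε n ≤ bowenC f W t ε n := by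
  unfold bowenC
  refine le_iInf fun c => le_iInf fun v => le_iInf fun hv => le_iInf fun hc => ?_
  exact iInf_le_of_le c (iInf_le_of_le v (iInf_le_of_le hv
    (iInf_le_of_le (hZW.trans hc) le_rfl)))

theorem bowenH_mono_set (f : X → X) {Z W : Set X} (hZW : Z ⊆ W) (ε : ℝ) :
    bowenH f Z ε ≤ bowenH f W ε := by
  unfold bowenH
  refine sInf_le_sInf (Set.image_mono ?_)
  intro t ht
  simp only [Set.mem_ofPred_eq] at *
  refine le_antisymm ?_ (zero_le)
  rw [← ht]
  exact iSup_mono fun n => bowenC_mono_set f hZW t ε n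

/-- Lower bound for the entropy at scale `ε` from a uniform lower bound on covers. -/
theorem le_bowenH (f : X → X) (Z : Set X) {t ε : ℝ} {C : ℝ≥0∞} (hC : C ≠ ⊤)
    (h : ∀ (c : ℕ → X) (v : ℕ → ℕ), Z ⊆ ⋃ i, bowenBall f (v i) (c i) ε →
      1 ≤ C * ∑' i, ENNReal.ofReal (Real.exp (-t * v i))) :
    ENNReal.ofReal t ≤ bowenH f Z ε := by
  unfold bowenH
  refine le_sInf ?_
  rintro _ ⟨s, hs, rfl⟩
  by_contra! hlt
  have hst : s ≤ t := by
    by_contra! h'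
    exact absurd (ENNReal.ofReal_le_ofReal h'.le) (not_le.2 hlt)
  have h0 : bowenC f Z s ε 0 = 0 := by
    refine le_antisymm ?_ zero_le
    rw [← show bowenCLim f Z s ε = 0 from hs]
    exact le_iSup (fun n => bowenC f Z s ε n) 0
  have h1 : C⁻¹ ≤ bowenC f Z s ε 0 := by
    unfold bowenC
    refine le_iInf fun c => le_iInf fun v => le_iInf fun hv => le_iInf fun hc => ?_
    have h2 := h c v hc
    have h3 : C⁻¹ ≤ ∑' i, ENNReal.ofReal (Real.exp (-t * v i)) := by
      rw [ENNReal.inv_le_iff_le_mul (fun _ => by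
        rintro h0; rw [h0, zero_mul] at h2; simp at h2) (fun h => absurd h hC)]
      exact h2
    refine h3.trans (ENNReal.tsum_le_tsum fun i => ENNReal.ofReal_le_ofReal ?_)
    apply Real.exp_le_exp.2
    have : (0 : ℝ) ≤ v i := Nat.cast_nonneg _
    nlinarith
  rw [h0] at h1
  simp [hC] at h1

/-- Many separated points. -/
theorem exists_separated [Nonempty X] (f : X → X) (Y : Set X) {ρ t : ℝ} (hρ : 0 < ρ) (ht : 0 ≤ t)
    (h : ENNReal.ofReal t < bowenH f Y ρ) (n0 : ℕ) :
    ∃ n, n0 ≤ n ∧ ∃ E : Finset X, (∀ x ∈ E, x ∈ Y) ∧ Real.exp (n * t) ≤ E.card ∧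
      ∀ x ∈ E, ∀ y ∈ E, x ≠ y → ∃ i < n, ρ ≤ dist (f^[i] x) (f^[i] y) := by
  classical
  by_contra! hcon
  obtain ⟨s, hs0, hts, hsH⟩ := ENNReal.lt_iff_exists_real_btwn.1 h
  have hts' : t < s := by
    by_contra! h'
    exact absurd (ENNReal.ofReal_le_ofReal h') (not_le.2 hts)
  have hspos : 0 < s := lt_of_le_of_lt ht hts'
  -- spanning sets
  have span : ∀ m, n0 ≤ m → ∃ E : Finset X, (E.card : ℝ) < Real.exp (m * t) ∧
      ∀ y ∈ Y, ∃ x ∈ E, y ∈ bowenBall f m x ρ := by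
    intro m hm
    by_contra! hno
    have hk : ∀ k : ℕ, ∃ E : Finset X, E.card = k ∧ (∀ x ∈ E, x ∈ Y) ∧
        ∀ x ∈ E, ∀ y ∈ E, x ≠ y → ∃ i < m, ρ ≤ dist (f^[i] x) (f^[i] y) := by
      intro k
      induction k with
      | zero => exact ⟨∅, by simp⟩
      | succ k ih =>
        obtain ⟨E, hEk, hEY, hEs⟩ := ih
        have hlt : (E.card : ℝ) < Real.exp (m * t) := by
          by_contra! h'
          obtain ⟨x, hx, y, hy, hxy, hb⟩ := hcon m hm E hEY h'
          obtain ⟨i, hi, hd⟩ := hEs x hx y hy hxy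
          exact absurd (hb i hi) (not_lt.2 hd)
        obtain ⟨y, hyY, hy⟩ := hno E hlt
        have hsep : ∀ x ∈ E, ∃ i < m, ρ ≤ dist (f^[i] x) (f^[i] y) := by
          intro x hx
          have := hy x hx
          simp only [bowenBall, Set.mem_ofPred_eq, not_forall, not_lt] at this
          obtain ⟨i, hi, hd⟩ := this
          exact ⟨i, hi, hd⟩
        have hyE : y ∉ E := by
          intro hyE
          obtain ⟨i, _, hd⟩ := hsep y hyE
          rw [dist_self] at hd
          linarith
        refine ⟨insert y E, by rw [Finset.card_insert_of_notMem hyE, hEk], ?_, ?_⟩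
        · intro x hx
          rcases Finset.mem_insert.1 hx with rfl | hx
          · exact hyY
          · exact hEY x hx
        · intro a ha b hb hab
          rcases Finset.mem_insert.1 ha with rfl | ha2
          · rcases Finset.mem_insert.1 hb with rfl | hb
            · exact absurd rfl hab
            · obtain ⟨i, hi, hd⟩ := hsep b hb
              exact ⟨i, hi, by rwa [dist_comm]⟩
          · rcases Finset.mem_insert.1 hb with rfl | hb
            · exact hsep a ha2
            · exact hEs a ha2 b hb hab
    obtain ⟨E, hEk, hEY, hEs⟩ := hk ⌈Real.exp (m * t)⌉₊
    obtain ⟨x, hx, y, hy, hxy, hb⟩ := hcon m hm E hEY (by rw [hEk]; exact Nat.le_ceil _)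
    obtain ⟨i, hi, hd⟩ := hEs x hx y hy hxy
    exact absurd (hb i hi) (not_lt.2 hd)
  set S : ℝ≥0∞ := ∑' i : ℕ, ENNReal.ofReal (Real.exp (-s * i)) with hS
  have hSfin : S ≠ ⊤ := by
    have hsum : Summable (fun i : ℕ => Real.exp (-s * i)) := by
      have := Real.summable_exp_nat_mul_iff (a := -s)
      simpa [mul_comm] using this.2 (by linarith)
    rw [hS, ← ENNReal.ofReal_tsum_of_nonneg (fun _ => (Real.exp_pos _).le) hsum]
    exact ENNReal.ofReal_ne_top
  have bound : ∀ m, n0 ≤ m → bowenC f Y s ρ m ≤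
      (1 + S) * ENNReal.ofReal (Real.exp (-(s - t) * m)) := by
    intro m hm
    obtain ⟨E, hEc, hE⟩ := span m hm
    obtain ⟨p⟩ := ‹Nonempty X›
    set c : ℕ → X := fun i => if h : i < E.card then (E.equivFin.symm ⟨i, h⟩ : X) else p with hc
    set v : ℕ → ℕ := fun i => if i < E.card then m else m + i with hv
    have hcov : Y ⊆ ⋃ i, bowenBall f (v i) (c i) ρ := by
      intro y hy
      obtain ⟨x, hx, hyx⟩ := hE y hy
      refine Set.mem_iUnion.2 ⟨E.equivFin ⟨x, hx⟩, ?_⟩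
      have hlt := (E.equivFin ⟨x, hx⟩).2
      simp only [hc, hv, hlt, if_true, dif_pos, Fin.eta, Equiv.symm_apply_apply]
      exact hyx
    have hvm : ∀ i, m ≤ v i := by
      intro i; simp only [hv]; split_ifs <;> omega
    have hle : bowenC f Y s ρ m ≤ ∑' i, ENNReal.ofReal (Real.exp (-s * v i)) := by
      unfold bowenC
      exact iInf_le_of_le c (iInf_le_of_le v (iInf_le_of_le hvm (iInf_le_of_le hcov le_rfl)))
    refine hle.trans ?_
    have hexp : Real.exp (-s * m) ≤ Real.exp (-(s - t) * m) := by
      apply Real.exp_le_exp.2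
      have : (0 : ℝ) ≤ m := Nat.cast_nonneg _
      nlinarith
    calc ∑' i, ENNReal.ofReal (Real.exp (-s * v i))
        ≤ ∑' i, ((if i ∈ Finset.range E.card then ENNReal.ofReal (Real.exp (-s * m)) else 0) +
            ENNReal.ofReal (Real.exp (-s * m)) * ENNReal.ofReal (Real.exp (-s * i))) := by
          refine ENNReal.tsum_le_tsum fun i => ?_
          simp only [hv, Finset.mem_range]
          split_ifs with hi
          · exact le_self_add
          · rw [zero_add, ← ENNReal.ofReal_mul (Real.exp_pos _).le, ← Real.exp_add]
            push_cast
            rw [mul_add]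
      _ = E.card * ENNReal.ofReal (Real.exp (-s * m)) +
            ENNReal.ofReal (Real.exp (-s * m)) * S := by
          rw [ENNReal.tsum_add, ENNReal.tsum_mul_left]
          congr 1
          rw [tsum_eq_sum (s := Finset.range E.card) (by
            intro i hi; rw [if_neg hi])]
          rw [Finset.sum_congr rfl (fun i hi => if_pos hi)]
          simp
      _ ≤ ENNReal.ofReal (Real.exp (-(s - t) * m)) +
            ENNReal.ofReal (Real.exp (-(s - t) * m)) * S := by
          gcongr
          rw [← ENNReal.ofReal_natCast, ← ENNReal.ofReal_mul (by positivity)]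
          apply ENNReal.ofReal_le_ofReal
          calc (E.card : ℝ) * Real.exp (-s * m) ≤ Real.exp (m * t) * Real.exp (-s * m) := by
                gcongr
            _ = Real.exp (-(s - t) * m) := by rw [← Real.exp_add]; congr 1; ring
      _ = _ := by ring
  have hlim : Tendsto (fun m : ℕ => (1 + S) * ENNReal.ofReal (Real.exp (-(s - t) * m)))
      atTop (𝓝 0) := by
    have h1 : Tendsto (fun m : ℕ => Real.exp (-(s - t) * m)) atTop (𝓝 0) := by
      apply Real.tendsto_exp_atBot.comp
      exact (tendsto_natCast_atTop_atTop).const_mul_atTop_of_neg (by linarith)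
    have h2 := ENNReal.tendsto_ofReal h1
    have h3 := ENNReal.Tendsto.const_mul (a := 1 + S) h2 (Or.inr (by simp [hSfin]))
    simpa using h3
  have hzero : bowenCLim f Y s ρ = 0 := by
    unfold bowenCLim
    simp only [ENNReal.iSup_eq_zero]
    intro n
    refine le_antisymm ?_ zero_le
    refine ge_of_tendsto hlim ?_
    filter_upwards [eventually_ge_atTop (max n n0)] with m hm
    exact (bowenC_mono_n f Y s ρ ((le_max_left _ _).trans hm)).trans
      (bound m ((le_max_right _ _).trans hm))
  have : bowenH f Y ρ ≤ ENNReal.ofReal s := sInf_le ⟨s, hzero, rfl⟩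
  exact absurd this (not_le.2 hsH)

/-- Covering the full shift by cylinders. -/
theorem cylinder_cover {K : ℕ} (hK : 0 < K) (F : ℕ → Finset ℕ) (w : ℕ → ℕ → Fin K)
    (h : ∀ ω : ℕ → Fin K, ∃ i, ∀ j ∈ F i, ω j = w i j) :
    1 ≤ ∑' i, ((K : ℝ≥0∞)⁻¹) ^ (F i).card := by
  have : Nonempty (Fin K) := ⟨⟨0, hK⟩⟩
  set ν : Measure (Fin K) := ProbabilityTheory.uniformOn Set.univ with hν
  have : IsProbabilityMeasure ν :=
    ProbabilityTheory.isProbabilityMeasure_uniformOn Set.finite_univ Set.univ_nonempty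
  have hsing : ∀ a : Fin K, ν {a} = (K : ℝ≥0∞)⁻¹ := by
    intro a
    rw [hν, ProbabilityTheory.uniformOn_univ]
    simp
  set μ := Measure.infinitePi (fun _ : ℕ => ν) with hμ
  have hcov : (Set.univ : Set (ℕ → Fin K)) ⊆
      ⋃ i, (↑(F i) : Set ℕ).pi (fun j => ({w i j} : Set (Fin K))) := by
    intro ω _
    obtain ⟨i, hi⟩ := h ω
    exact Set.mem_iUnion.2 ⟨i, fun j hj => hi j hj⟩
  calc (1 : ℝ≥0∞) = μ Set.univ := measure_univ.symm
    _ ≤ μ (⋃ i, (↑(F i) : Set ℕ).pi (fun j => ({w i j} : Set (Fin K)))) := measure_mono hcov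
    _ ≤ ∑' i, μ ((↑(F i) : Set ℕ).pi (fun j => ({w i j} : Set (Fin K)))) := measure_iUnion_le _
    _ = _ := by
      congr 1
      ext i
      rw [hμ, Measure.infinitePi_pi _ (fun _ _ => measurableSet_singleton _)]
      simp [hsing]

/-- Oscillating phases. -/
theorem exists_phase : ∃ ph : ℕ → Prop, ∀ (_ : DecidablePred ph) (ℓ : ℝ),
    ¬ ∀ᶠ Q : ℕ in atTop, |((((Finset.range Q).filter ph).card : ℕ) : ℝ) - Q * ℓ| ≤ Q * (1 / 10) := by
  refine ⟨fun r => Even (Nat.log 2 r), fun _ ℓ hev => ?_⟩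
  obtain ⟨N, hN⟩ := eventually_atTop.1 hev
  set c : ℕ → ℕ := fun Q => ((Finset.range Q).filter fun r => Even (Nat.log 2 r)).card with hc
  have hpow : N ≤ 2 ^ (2 * N) := by
    calc N ≤ 2 * N := by omega
      _ ≤ 2 ^ (2 * N) := Nat.lt_two_pow_self.le
  have h1 : 2 ^ (2 * N) ≤ c (2 ^ (2 * N + 1)) := by
    have : Finset.Ico (2 ^ (2 * N)) (2 ^ (2 * N + 1)) ⊆
        (Finset.range (2 ^ (2 * N + 1))).filter fun r => Even (Nat.log 2 r) := by
      intro r hr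
      rw [Finset.mem_Ico] at hr
      rw [Finset.mem_filter, Finset.mem_range]
      refine ⟨hr.2, ?_⟩
      rw [Nat.log_eq_of_pow_le_of_lt_pow hr.1 hr.2]
      exact even_two_mul N
    have h2 := Finset.card_le_card this
    rw [Nat.card_Ico, pow_succ] at h2
    simp only [hc]
    rw [pow_succ]
    omega
  have h2 : c (2 ^ (2 * N + 2)) ≤ c (2 ^ (2 * N + 1)) := by
    refine Finset.card_le_card ?_
    intro r hr
    rw [Finset.mem_filter, Finset.mem_range] at *
    refine ⟨?_, hr.2⟩
    by_contra! h'
    have h3 := hr.2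
    rw [Nat.log_eq_of_pow_le_of_lt_pow h' hr.1] at h3
    rw [Nat.even_iff] at h3
    omega
  have e1 := hN (2 ^ (2 * N + 1)) (hpow.trans (Nat.pow_le_pow_right (by norm_num) (by omega)))
  have e2 := hN (2 ^ (2 * N + 2)) (hpow.trans (Nat.pow_le_pow_right (by norm_num) (by omega)))
  change |(c (2 ^ (2 * N + 1)) : ℝ) - _| ≤ _ at e1
  change |(c (2 ^ (2 * N + 2)) : ℝ) - _| ≤ _ at e2
  have h1' : ((2 : ℝ) ^ (2 * N)) ≤ c (2 ^ (2 * N + 1)) := by exact_mod_cast h1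
  have h2' : (c (2 ^ (2 * N + 2)) : ℝ) ≤ c (2 ^ (2 * N + 1)) := by exact_mod_cast h2
  have h3 : c (2 ^ (2 * N + 1)) ≤ c (2 ^ (2 * N + 2)) := by
    refine Finset.card_le_card (Finset.filter_subset_filter _ (Finset.range_mono ?_))
    exact Nat.pow_le_pow_right (by norm_num) (by omega)
  have h3' : (c (2 ^ (2 * N + 1)) : ℝ) ≤ c (2 ^ (2 * N + 2)) := by exact_mod_cast h3
  rw [abs_le] at e1 e2
  push_cast at e1 e2
  rw [pow_succ] at e1
  rw [pow_add] at e2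
  have hA : (0 : ℝ) < 2 ^ (2 * N) := by positivity
  generalize (2 : ℝ) ^ (2 * N) = A at *
  nlinarith

/-- comparing scales in the mean dimensions -/
theorem scale_key {c c' : ℝ} (hc : 0 ≤ c) (hcc : c < c') (hY hI : ℝ → ℝ≥0∞)
    (h : ∀ ε, 0 < ε → hY (4 * ε) ≤ hI ε) :
    ∀ᶠ ε in 𝓝[>] (0 : ℝ), ENNReal.ofReal c' < hY (4 * ε) / ENNReal.ofReal (-Real.log (4 * ε)) →
      ENNReal.ofReal c ≤ hI ε / ENNReal.ofReal (-Real.log ε) := by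
  have hlog : Tendsto (fun ε : ℝ => -Real.log ε) (𝓝[>] 0) atTop :=
    tendsto_neg_atBot_atTop.comp Real.tendsto_log_nhdsGT_zero
  filter_upwards [hlog.eventually_ge_atTop (c' * Real.log 4 / (c' - c)),
    hlog.eventually_gt_atTop (Real.log 4), hlog.eventually_gt_atTop 0,
    self_mem_nhdsWithin] with ε h1 h2 h3 h4 h5
  have h4 : 0 < ε := h4
  have hl : -Real.log (4 * ε) = -Real.log ε - Real.log 4 := by
    rw [Real.log_mul (by norm_num) h4.ne']; ring
  have hpos : 0 < -Real.log (4 * ε) := by rw [hl]; linarith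
  rw [ENNReal.le_div_iff_mul_le (Or.inl (by simpa using h3)) (Or.inl ENNReal.ofReal_ne_top)]
  have h6 := h5.le
  rw [ENNReal.le_div_iff_mul_le (Or.inl (by simpa using hpos)) (Or.inl ENNReal.ofReal_ne_top)] at h6
  refine le_trans ?_ (h6.trans (h ε h4))
  rw [← ENNReal.ofReal_mul hc, ← ENNReal.ofReal_mul (by linarith)]
  apply ENNReal.ofReal_le_ofReal
  rw [hl]
  rw [div_le_iff₀ (by linarith)] at h1
  nlinarith

theorem tendsto_const_mul_nhdsGT {a : ℝ} (ha : 0 < a) :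
    Tendsto (fun ε : ℝ => a * ε) (𝓝[>] 0) (𝓝[>] 0) := by
  refine tendsto_nhdsWithin_iff.2 ⟨?_, ?_⟩
  · have : Tendsto (fun ε : ℝ => a * ε) (𝓝 0) (𝓝 (a * 0)) := (continuous_const_mul a).tendsto 0
    rw [mul_zero] at this
    exact this.mono_left nhdsWithin_le_nhds
  · filter_upwards [self_mem_nhdsWithin] with ε hε
    exact mul_pos ha hε

theorem scale_liminf (hY hI : ℝ → ℝ≥0∞) (h : ∀ ε, 0 < ε → hY (4 * ε) ≤ hI ε) :
    liminf (fun ε : ℝ => hY ε / ENNReal.ofReal (-Real.log ε)) (𝓝[>] 0) ≤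
    liminf (fun ε : ℝ => hI ε / ENNReal.ofReal (-Real.log ε)) (𝓝[>] 0) := by
  refine le_of_forall_lt fun b hb => ?_
  obtain ⟨c, hc0, hbc, hc⟩ := ENNReal.lt_iff_exists_real_btwn.1 hb
  obtain ⟨c', hc0', hcc, hc'⟩ := ENNReal.lt_iff_exists_real_btwn.1 hc
  have hcc' : c < c' := by
    by_contra! h'
    exact absurd (ENNReal.ofReal_le_ofReal h') (not_le.2 hcc)
  refine hbc.trans_le (le_liminf_of_le (by isBoundedDefault) ?_)
  have h1 := (tendsto_const_mul_nhdsGT (show (0 : ℝ) < 4 by norm_num)).eventually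
    (eventually_lt_of_lt_liminf hc')
  filter_upwards [h1, scale_key hc0 hcc' hY hI h] with ε e1 e2
  exact e2 e1

theorem scale_limsup (hY hI : ℝ → ℝ≥0∞) (h : ∀ ε, 0 < ε → hY (4 * ε) ≤ hI ε) :
    limsup (fun ε : ℝ => hY ε / ENNReal.ofReal (-Real.log ε)) (𝓝[>] 0) ≤
    limsup (fun ε : ℝ => hI ε / ENNReal.ofReal (-Real.log ε)) (𝓝[>] 0) := by
  refine le_of_forall_lt fun b hb => ?_
  obtain ⟨c, hc0, hbc, hc⟩ := ENNReal.lt_iff_exists_real_btwn.1 hb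
  obtain ⟨c', hc0', hcc, hc'⟩ := ENNReal.lt_iff_exists_real_btwn.1 hc
  have hcc' : c < c' := by
    by_contra! h'
    exact absurd (ENNReal.ofReal_le_ofReal h') (not_le.2 hcc)
  refine hbc.trans_le (le_limsup_of_frequently_le ?_ (by isBoundedDefault))
  have h1 := frequently_lt_of_lt_limsup (by isBoundedDefault) hc'
  intro hcon
  apply h1
  have h2 : ∀ᶠ ε in 𝓝[>] (0 : ℝ),
      ¬ ENNReal.ofReal c' < hY (4 * ε) / ENNReal.ofReal (-Real.log (4 * ε)) := by
    filter_upwards [hcon, scale_key hc0 hcc' hY hI h] with ε e1 e2 e3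
    exact e1 (e2 e3)
  have h3 := (tendsto_const_mul_nhdsGT (show (0 : ℝ) < 1 / 4 by norm_num)).eventually h2
  filter_upwards [h3] with ε e1
  rwa [show (4 : ℝ) * (1 / 4 * ε) = ε by ring] at e1

/-- a point of the class with large Birkhoff sum -/
theorem exists_large_sum [CompactSpace X] [MeasurableSpace X] [BorelSpace X]
    {f : X → X} {Y : Set X} (hYc : IsClosed Y) (hf : Continuous f)
    {Φ : X → ℝ} (hΦ : Continuous Φ) (μ : Measure X) [IsProbabilityMeasure μ]
    (hμ : MeasurePreserving f μ μ) (hμY : μ Y = 1) (n : ℕ) :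
    ∃ x ∈ Y, n * ∫ x, Φ x ∂μ ≤ ∑ i ∈ Finset.range n, Φ (f^[i] x) := by
  have hintg : ∀ i, Integrable (fun x => Φ (f^[i] x)) μ := fun i =>
    (hΦ.comp (hf.iterate i)).integrable_of_hasCompactSupport
      (HasCompactSupport.of_compactSpace _)
  have hnull : μ Yᶜ = 0 := by
    rw [measure_compl hYc.measurableSet (by simp), measure_univ, hμY, tsub_self]
  obtain ⟨x, hx, hle⟩ := exists_notMem_null_integral_le
    (integrable_finsetSum (Finset.range n) fun i _ => hintg i) hnull
  refine ⟨x, by simpa using hx, ?_⟩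
  rw [integral_finsetSum _ fun i _ => hintg i] at hle
  have : ∀ i, ∫ x, Φ (f^[i] x) ∂μ = ∫ x, Φ x ∂μ := by
    intro i
    have hm := hμ.iterate i
    have := integral_map (μ := μ) (φ := f^[i]) hm.measurable.aemeasurable
      (f := Φ) hΦ.aestronglyMeasurable
    rw [hm.map_eq] at this
    exact this.symm
  simpa [this] using hle


theorem block_sum_bound (F : ℕ → ℝ) (a : ℕ → ℝ) (P : ℕ) (e : ℝ) (Q : ℕ)
    (h : ∀ r < Q, |∑ i ∈ Finset.range P, F (r * P + i) - a r| ≤ e) :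
    |∑ t ∈ Finset.range (Q * P), F t - ∑ r ∈ Finset.range Q, a r| ≤ Q * e := by
  induction Q with
  | zero => simp
  | succ Q ih =>
    have h1 := ih fun r hr => h r (by omega)
    have h2 := h Q (by omega)
    rw [Nat.succ_mul, Finset.sum_range_add, Finset.sum_range_succ]
    rw [abs_le] at *
    push_cast
    constructor <;> linarith [h1.1, h1.2, h2.1, h2.2]

/-- Criterion for irregularity. -/
theorem irregular_of_sums {f : X → X} {Φ : X → ℝ} {ph : ℕ → Prop} [DecidablePred ph]
    (hph : ∀ (ℓ : ℝ), ¬ ∀ᶠ Q : ℕ in atTop,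
      |((((Finset.range Q).filter ph).card : ℕ) : ℝ) - Q * ℓ| ≤ Q * (1 / 10))
    {v : X} {P : ℕ} (hP : 1 ≤ P) {b c e : ℝ} (he : 0 < e) (hb : P * (2 * e) ≤ |b| / 10)
    (h : ∀ Q : ℕ, |∑ t ∈ Finset.range (Q * P), Φ (f^[t] v) -
      (Q * (P * c) + (((Finset.range Q).filter ph).card : ℕ) * b)| ≤ Q * (P * e)) :
    v ∈ IrregularSet f Φ := by
  rintro ⟨l, hl⟩
  have hP0 : (0 : ℝ) < P := by exact_mod_cast hP
  have hb0 : 0 < |b| := by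
    have : 0 < P * (2 * e) := by positivity
    linarith
  refine hph (P * (l - c) / b) ?_
  have hsub : Tendsto (fun Q : ℕ => Q * P) atTop atTop :=
    tendsto_id.atTop_mul_const' (by omega)
  have h1 := Metric.tendsto_nhds.1 (hl.comp hsub) e he
  filter_upwards [h1, eventually_ge_atTop 1] with Q h2 hQ
  have hQ0 : (0 : ℝ) < Q := by exact_mod_cast hQ
  have h3 := h Q
  rw [Function.comp_apply, Real.dist_eq, birkhoffAvg] at h2
  set S := ∑ t ∈ Finset.range (Q * P), Φ (f^[t] v) with hS
  set n : ℝ := ((((Finset.range Q).filter ph).card : ℕ) : ℝ) with hn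
  have h4 : |S - Q * P * l| ≤ Q * (P * e) := by
    have : S - Q * P * l = (Q * P) * (1 / ((Q * P : ℕ) : ℝ) * S - l) := by
      push_cast; field_simp
    rw [this, abs_mul, abs_of_pos (by positivity), mul_assoc]
    gcongr
  have h5 : |n * b - Q * (P * (l - c))| ≤ Q * (P * (2 * e)) := by
    rw [abs_le] at *
    constructor <;> nlinarith [h3.1, h3.2, h4.1, h4.2]
  have hbne : b ≠ 0 := abs_pos.1 hb0
  have h6 : n - Q * (P * (l - c) / b) = (n * b - Q * (P * (l - c))) / b := by
    field_simp
  rw [h6, abs_div, div_le_iff₀ hb0]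
  calc _ ≤ (Q : ℝ) * (P * (2 * e)) := h5
    _ ≤ Q * (|b| / 10) := by gcongr
    _ = _ := by ring

/-- concatenation of loops of length `L` -/
def zF {K : ℕ} (L : ℕ) (g : Fin K → ℕ → X) (ω : ℕ → Fin K) (t : ℕ) : X :=
  g (ω (t / L)) (t % L)

open Classical in
/-- the schedule: free loops, with special loops at the start of marked large blocks -/
noncomputable def zseq {K : ℕ} (L L' R : ℕ) (g : Fin K → ℕ → X) (w : ℕ → X) (ph : ℕ → Prop)
    (ω : ℕ → Fin K) (t : ℕ) : X :=
  if t % (R * (L * L')) < L * L' ∧ ph (t / (R * (L * L'))) then w (t % L') else zF L g ω t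

theorem mod_succ_cases {t L : ℕ} (hL : 1 ≤ L) :
    (t % L + 1 < L ∧ (t + 1) % L = t % L + 1 ∧ (t + 1) / L = t / L) ∨
    (t % L + 1 = L ∧ (t + 1) % L = 0) := by
  have hlt := Nat.mod_lt t (show L > 0 by omega)
  have hdm := Nat.div_add_mod t L
  rcases lt_or_ge (t % L + 1) L with h | h
  · left
    have e : t + 1 = (t % L + 1) + L * (t / L) := by omega
    refine ⟨h, ?_, ?_⟩
    · conv_lhs => rw [e]
      rw [Nat.add_mul_mod_self_left, Nat.mod_eq_of_lt h]
    · conv_lhs => rw [e]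
      rw [Nat.add_mul_div_left _ _ (by omega), Nat.div_eq_of_lt h, zero_add]
  · right
    have e : t % L + 1 = L := by omega
    refine ⟨e, ?_⟩
    rw [← Nat.mod_add_mod, e, Nat.mod_self]

theorem zF_chain {f : X → X} {δ : ℝ} {K L : ℕ} (hL : 1 ≤ L) {p : X} {g : Fin K → ℕ → X}
    (g0 : ∀ k, g k 0 = p) (gL : ∀ k, g k L = p)
    (hg : ∀ k, ∀ i < L, dist (f (g k i)) (g k (i + 1)) < δ) (ω : ℕ → Fin K) (t : ℕ) :
    dist (f (zF L g ω t)) (zF L g ω (t + 1)) < δ := by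
  unfold zF
  have hlt := Nat.mod_lt t (show L > 0 by omega)
  have h1 := hg (ω (t / L)) (t % L) hlt
  rcases mod_succ_cases (t := t) hL with ⟨_, h2, h3⟩ | ⟨h2, h3⟩
  · rw [h2, h3]; exact h1
  · rw [h3, g0]; rw [h2, gL] at h1; exact h1

theorem w_chain {f : X → X} {δ : ℝ} {L : ℕ} (hL : 1 ≤ L) {p : X} {w : ℕ → X}
    (w0 : w 0 = p) (wL : w L = p)
    (hw : ∀ i < L, dist (f (w i)) (w (i + 1)) < δ) (t : ℕ) :
    dist (f (w (t % L))) (w ((t + 1) % L)) < δ := by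
  have hlt := Nat.mod_lt t (show L > 0 by omega)
  have h1 := hw (t % L) hlt
  rcases mod_succ_cases (t := t) hL with ⟨_, h2, h3⟩ | ⟨h2, h3⟩
  · rw [h2]; exact h1
  · rw [h3, w0]; rw [h2, wL] at h1; exact h1

theorem zseq_mul {K : ℕ} {L L' R : ℕ} {p : X} {g : Fin K → ℕ → X} {w : ℕ → X}
    (g0 : ∀ k, g k 0 = p) (w0 : w 0 = p) (ph : ℕ → Prop) (ω : ℕ → Fin K) {t : ℕ}
    (h : (L * L') ∣ t) : zseq L L' R g w ph ω t = p ∧ w (t % L') = p ∧ zF L g ω t = p := by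
  have h1 : t % L' = 0 := Nat.mod_eq_zero_of_dvd ((Dvd.intro_left _ rfl).trans h)
  have h2 : t % L = 0 := Nat.mod_eq_zero_of_dvd ((Dvd.intro _ rfl).trans h)
  have e2 : zF L g ω t = p := by rw [zF, h2, g0]
  refine ⟨?_, by rw [h1, w0], e2⟩
  unfold zseq
  split_ifs
  · rw [h1, w0]
  · exact e2

theorem zseq_chain {f : X → X} {δ : ℝ} {K L L' R : ℕ} (hL : 1 ≤ L) (hL' : 1 ≤ L') (hR : 1 ≤ R)
    {p : X} {g : Fin K → ℕ → X} {w : ℕ → X}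
    (g0 : ∀ k, g k 0 = p) (gL : ∀ k, g k L = p)
    (hg : ∀ k, ∀ i < L, dist (f (g k i)) (g k (i + 1)) < δ)
    (w0 : w 0 = p) (wL : w L' = p)
    (hw : ∀ i < L', dist (f (w i)) (w (i + 1)) < δ) (ph : ℕ → Prop) (ω : ℕ → Fin K) (t : ℕ) :
    dist (f (zseq L L' R g w ph ω t)) (zseq L L' R g w ph ω (t + 1)) < δ := by
  have c1 := zF_chain hL g0 gL hg ω t
  have c2 := w_chain hL' w0 wL hw t
  by_cases hd : (L * L') ∣ (t + 1)
  · obtain ⟨e1, e2, e3⟩ := zseq_mul (R := R) g0 w0 ph ω hd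
    rw [e1]
    rw [e3] at c1
    rw [e2] at c2
    unfold zseq
    split_ifs
    · exact c2
    · exact c1
  · have hP : 1 ≤ R * (L * L') := Nat.mul_pos hR (Nat.mul_pos hL hL')
    rcases mod_succ_cases (t := t) hP with ⟨h1, h2, h3⟩ | ⟨h2, h3⟩
    · have hiff : (t + 1) % (R * (L * L')) < L * L' ↔ t % (R * (L * L')) < L * L' := by
        rw [h2]
        constructor
        · intro h; omega
        · intro h
          by_contra h'
          have e : t % (R * (L * L')) + 1 = L * L' := by omega
          rw [← h2] at e
          apply hd
          have := Nat.dvd_of_mod_eq_zero (show ((t + 1) % (R * (L * L'))) % (L * L') = 0 by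
            rw [e, Nat.mod_self])
          exact (Nat.dvd_mod_iff (Dvd.intro_left _ rfl)).1 this
      have hc : ((t + 1) % (R * (L * L')) < L * L' ∧ ph ((t + 1) / (R * (L * L')))) ↔
          (t % (R * (L * L')) < L * L' ∧ ph (t / (R * (L * L')))) := by rw [hiff, h3]
      by_cases hm : t % (R * (L * L')) < L * L' ∧ ph (t / (R * (L * L')))
      · unfold zseq
        rw [if_pos hm, if_pos (hc.2 hm)]
        exact c2
      · unfold zseq
        rw [if_neg hm, if_neg (fun h => hm (hc.1 h))]
        exact c1
    · exact absurd ((Dvd.intro_left _ rfl).trans (Nat.dvd_of_mod_eq_zero h3)) hd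

theorem zF_sum {K L : ℕ} (hL : 1 ≤ L) {g : Fin K → ℕ → X} {Φ : X → ℝ} {c e : ℝ}
    (hs : ∀ k, |∑ i ∈ Finset.range L, Φ (g k i) - L * c| ≤ L * e) (ω : ℕ → Fin K) (s m : ℕ)
    (hd : L ∣ s) :
    |∑ i ∈ Finset.range (m * L), Φ (zF L g ω (s + i)) - m * (L * c)| ≤ m * (L * e) := by
  obtain ⟨q, rfl⟩ := hd
  have := block_sum_bound (fun i => Φ (zF L g ω (L * q + i))) (fun _ => L * c) L (L * e) m ?_
  · simpa using this
  · intro r _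
    convert hs (ω (q + r)) using 4 with i hi
    have hi' := Finset.mem_range.1 hi
    have e1 : L * q + (r * L + i) = i + L * (q + r) := by ring
    rw [zF, e1, Nat.add_mul_mod_self_left, Nat.mod_eq_of_lt hi',
      Nat.add_mul_div_left _ _ (by omega), Nat.div_eq_of_lt hi', zero_add]

theorem w_sum {L' : ℕ} (w : ℕ → X) (Φ : X → ℝ) (s m : ℕ) (hd : L' ∣ s) :
    ∑ i ∈ Finset.range (m * L'), Φ (w ((s + i) % L')) =
      m * ∑ i ∈ Finset.range L', Φ (w i) := by
  obtain ⟨q, rfl⟩ := hd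
  have := block_sum_bound (fun i => Φ (w ((L' * q + i) % L')))
    (fun _ => ∑ i ∈ Finset.range L', Φ (w i)) L' 0 m ?_
  · simp only [mul_zero, abs_nonpos_iff, sub_eq_zero, Finset.sum_const, Finset.card_range,
      nsmul_eq_mul] at this
    exact this
  · intro r _
    rw [abs_nonpos_iff, sub_eq_zero]
    refine Finset.sum_congr rfl fun i hi => ?_
    have hi' := Finset.mem_range.1 hi
    have e1 : L' * q + (r * L' + i) = i + L' * (q + r) := by ring
    rw [e1, Nat.add_mul_mod_self_left, Nat.mod_eq_of_lt hi']

open Classical in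
theorem zseq_sum {K L L' R : ℕ} (hL : 1 ≤ L) (hL' : 1 ≤ L')
    {g : Fin K → ℕ → X} {w : ℕ → X} {Φ : X → ℝ} {c e D : ℝ} (he : 0 ≤ e)
    (hs : ∀ k, |∑ i ∈ Finset.range L, Φ (g k i) - L * c| ≤ L * e)
    (hwS : ∑ i ∈ Finset.range L', Φ (w i) = L' * (c + D))
    (ph : ℕ → Prop) (ω : ℕ → Fin K) (Q : ℕ) :
    |∑ t ∈ Finset.range (Q * ((R + 1) * (L * L'))), Φ (zseq L L' (R + 1) g w ph ω t) -
      (Q * (((R + 1) * (L * L') : ℕ) * c) +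
        (((Finset.range Q).filter ph).card : ℕ) * (L * L' * D))| ≤
      Q * (((R + 1) * (L * L') : ℕ) * e) := by
  set P := (R + 1) * (L * L') with hP
  have hP0 : 0 < P := Nat.mul_pos (by omega) (Nat.mul_pos hL hL')
  have key := block_sum_bound (fun t => Φ (zseq L L' (R + 1) g w ph ω t))
    (fun r => P * c + if ph r then (L * L' * D) else 0) P (P * e) Q ?_
  · rw [Finset.sum_add_distrib, ← Finset.sum_filter] at key
    simpa using key
  · intro r _
    have hPs : P = L * L' + R * (L * L') := by rw [hP]; ring
    have hPR : (P : ℝ) = L * L' + R * (L * L') := by rw [hPs]; push_cast; ring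
    have hdiv : ∀ i < P, (r * P + i) % P = i ∧ (r * P + i) / P = r := by
      intro i hi
      rw [add_comm, Nat.add_mul_mod_self_right, Nat.mod_eq_of_lt hi,
        Nat.add_mul_div_right _ _ hP0, Nat.div_eq_of_lt hi, zero_add]
      exact ⟨rfl, rfl⟩
    have hLP : L ∣ P := ⟨(R + 1) * L', by rw [hP]; ring⟩
    have hLP' : L' ∣ P := ⟨(R + 1) * L, by rw [hP]; ring⟩
    have hrange : Finset.range P = Finset.range (L * L' + R * (L * L')) := by rw [← hPs]
    rw [hrange, Finset.sum_range_add]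
    have second : |∑ i ∈ Finset.range (R * (L * L')),
        Φ (zseq L L' (R + 1) g w ph ω (r * P + (L * L' + i))) - R * (L * L' * c)|
        ≤ R * (L * L' * e) := by
      have h1 := zF_sum hL hs ω (r * P + L * L') (R * L')
        (Dvd.dvd.add (hLP.mul_left r) ⟨L', rfl⟩)
      rw [show R * L' * L = R * (L * L') by ring] at h1
      have h2 : ∀ i ∈ Finset.range (R * (L * L')),
          Φ (zseq L L' (R + 1) g w ph ω (r * P + (L * L' + i))) =
          Φ (zF L g ω (r * P + L * L' + i)) := by
        intro i hi
        have hi' := Finset.mem_range.1 hi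
        have := (hdiv (L * L' + i) (by omega)).1
        rw [zseq, ← hP, this, if_neg (by omega), add_assoc]
      rw [Finset.sum_congr rfl h2]
      push_cast at h1
      convert h1 using 1
      · congr 1; ring
      · ring
    have first : |∑ i ∈ Finset.range (L * L'),
        Φ (zseq L L' (R + 1) g w ph ω (r * P + i)) -
          (L * L' * c + if ph r then (L * L' * D) else 0)| ≤ L * L' * e := by
      by_cases hr : ph r
      · have h2 : ∀ i ∈ Finset.range (L * L'),
            Φ (zseq L L' (R + 1) g w ph ω (r * P + i)) = Φ (w ((r * P + i) % L')) := by
          intro i hi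
          have hi' := Finset.mem_range.1 hi
          obtain ⟨e1, e2⟩ := hdiv i (by omega)
          rw [zseq, ← hP, e1, e2, if_pos ⟨hi', hr⟩]
        rw [Finset.sum_congr rfl h2, w_sum w Φ (r * P) L (hLP'.mul_left r), hwS, if_pos hr]
        have : (L : ℝ) * (L' * (c + D)) - (L * L' * c + L * L' * D) = 0 := by ring
        rw [this, abs_zero]
        positivity
      · have h1 := zF_sum hL hs ω (r * P) L' (hLP.mul_left r)
        rw [show L' * L = L * L' by ring] at h1
        have h2 : ∀ i ∈ Finset.range (L * L'),
            Φ (zseq L L' (R + 1) g w ph ω (r * P + i)) = Φ (zF L g ω (r * P + i)) := by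
          intro i hi
          have hi' := Finset.mem_range.1 hi
          obtain ⟨e1, e2⟩ := hdiv i (by omega)
          rw [zseq, ← hP, e1, e2, if_neg (by tauto)]
        rw [Finset.sum_congr rfl h2, if_neg hr]
        convert h1 using 1
        · congr 1; ring
        · ring
    rw [abs_le] at *
    rw [hPR]
    constructor <;> linarith [first.1, first.2, second.1, second.2]

theorem core_bound {f : X → X} {Φ : X → ℝ} {Y : Set X} {p : X} {δ ε ε' e c D t : ℝ}
    {K L L' R : ℕ} (hK : 0 < K) (hL : 1 ≤ L) (hL' : 1 ≤ L')
    (he : 0 < e) (hεε : ε' ≤ ε) (ht : 0 ≤ t)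
    (hshY : ∀ (z : ℕ → X) (P : ℕ), 1 ≤ P → (∀ Q, z (Q * P) = p) →
      (∀ n, dist (f (z n)) (z (n + 1)) < δ) → ∃ v ∈ Y, ∀ n, dist (f^[n] v) (z n) < ε')
    (hΦe : ∀ x y, dist x y < ε' → |Φ x - Φ y| ≤ e)
    {g : Fin K → ℕ → X} {w : ℕ → X}
    (g0 : ∀ k, g k 0 = p) (gL : ∀ k, g k L = p)
    (hg : ∀ k, ∀ i < L, dist (f (g k i)) (g k (i + 1)) < δ)
    (hsep : ∀ k l, k ≠ l → ∃ i < L, 4 * ε ≤ dist (g k i) (g l i))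
    (hs : ∀ k, |∑ i ∈ Finset.range L, Φ (g k i) - L * c| ≤ L * e)
    (w0 : w 0 = p) (wL : w L' = p)
    (hw : ∀ i < L', dist (f (w i)) (w (i + 1)) < δ)
    (hwS : ∑ i ∈ Finset.range L', Φ (w i) = L' * (c + D))
    (hD : (R + 1) * (4 * e) ≤ |D| / 10)
    (hKt : Real.exp (t * ((R + 1) * (L * L'))) ≤ (K : ℝ) ^ (R * L')) :
    ENNReal.ofReal t ≤ bowenH f (IrregularSet f Φ ∩ Y) ε := by
  classical
  obtain ⟨ph, hph⟩ := exists_phase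
  set P := (R + 1) * (L * L') with hP
  have hLL : 0 < L * L' := Nat.mul_pos hL hL'
  have hP0 : 0 < P := Nat.mul_pos (by omega) hLL
  have hex : ∀ ω : ℕ → Fin K, ∃ v ∈ IrregularSet f Φ ∩ Y,
      ∀ n, dist (f^[n] v) (zseq L L' (R + 1) g w ph ω n) < ε' := by
    intro ω
    obtain ⟨v, hvY, hv⟩ := hshY (zseq L L' (R + 1) g w ph ω) P hP0
      (fun Q => (zseq_mul g0 w0 ph ω ⟨Q * (R + 1), by rw [hP]; ring⟩).1)
      (zseq_chain hL hL' (by omega) g0 gL hg w0 wL hw ph ω)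
    refine ⟨v, ⟨?_, hvY⟩, hv⟩
    refine irregular_of_sums (hph _) hP0 (b := L * L' * D) (c := c) (e := 2 * e) (by linarith)
      ?_ ?_
    · rw [abs_mul, abs_of_nonneg (by positivity : (0 : ℝ) ≤ L * L'), hP]
      push_cast
      have : (0 : ℝ) ≤ L * L' := by positivity
      calc ((R : ℝ) + 1) * (L * L') * (2 * (2 * e)) = L * L' * ((R + 1) * (4 * e)) := by ring
        _ ≤ L * L' * (|D| / 10) := by gcongr
        _ = _ := by ring
    · intro Q
      have h1 := zseq_sum (R := R) hL hL' he.le hs hwS ph ω Q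
      rw [← hP] at h1
      have h2 : |∑ t ∈ Finset.range (Q * P), Φ (f^[t] v) -
          ∑ t ∈ Finset.range (Q * P), Φ (zseq L L' (R + 1) g w ph ω t)| ≤ Q * (P * e) := by
        rw [← Finset.sum_sub_distrib]
        refine (Finset.abs_sum_le_sum_abs _ _).trans ?_
        refine (Finset.sum_le_sum fun t _ => hΦe _ _ (hv t)).trans ?_
        simp [mul_assoc]
      rw [abs_le] at *
      constructor <;> linarith [h1.1, h1.2, h2.1, h2.2]
  choose π hπ hπd using hex
  have hC : ENNReal.ofReal (Real.exp (t * P)) ≠ ⊤ := ENNReal.ofReal_ne_top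
  refine le_bowenH f _ hC fun cc v hcov => ?_
  set m := (R + 1) * L' with hm
  have hm0 : 0 < m := Nat.mul_pos (by omega) hL'
  have hPm : P = m * L := by rw [hP, hm]; ring
  set F : ℕ → Finset ℕ := fun i =>
    ((Finset.range (v i / P)) ×ˢ (Finset.Ico L' m)).image (fun q => q.1 * m + q.2) with hF
  have hFcard : ∀ i, (F i).card = (v i / P) * (R * L') := by
    intro i
    simp only [hF]
    rw [Finset.card_image_of_injOn, Finset.card_product, Finset.card_range, Nat.card_Ico]
    · congr 1; rw [hm, Nat.succ_mul]; omega
    · rintro ⟨a, b⟩ hab ⟨a', b'⟩ hab' h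
      simp only [Finset.coe_product, Set.mem_prod, Finset.mem_coe, Finset.mem_range,
        Finset.mem_Ico] at hab hab'
      simp only at h
      have h1 : (a * m + b) % m = b := by
        rw [add_comm, Nat.add_mul_mod_self_right, Nat.mod_eq_of_lt hab.2.2]
      have h2 : (a' * m + b') % m = b' := by
        rw [add_comm, Nat.add_mul_mod_self_right, Nat.mod_eq_of_lt hab'.2.2]
      have hb : b = b' := by rw [← h1, ← h2, h]
      subst hb
      have : a * m = a' * m := by omega
      have := Nat.eq_of_mul_eq_mul_right hm0 this
      rw [this]
  have hω0 : Nonempty (ℕ → Fin K) := ⟨fun _ => ⟨0, hK⟩⟩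
  set W : ℕ → ℕ → Fin K := fun i =>
    if h : ∃ ω, π ω ∈ bowenBall f (v i) (cc i) ε then h.choose else fun _ => ⟨0, hK⟩ with hW
  have hWmem : ∀ i ω, π ω ∈ bowenBall f (v i) (cc i) ε →
      π (W i) ∈ bowenBall f (v i) (cc i) ε := by
    intro i ω hω
    have h : ∃ ω, π ω ∈ bowenBall f (v i) (cc i) ε := ⟨ω, hω⟩
    simp only [hW, dif_pos h]
    exact h.choose_spec
  have hcyl := cylinder_cover hK F W (by
    intro ω
    obtain ⟨i, hi⟩ := Set.mem_iUnion.1 (hcov (hπ ω))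
    refine ⟨i, fun j hj => ?_⟩
    have hi2 := hWmem i ω hi
    simp only [hF, Finset.mem_image, Finset.mem_product, Finset.mem_range, Finset.mem_Ico] at hj
    obtain ⟨⟨q, b⟩, ⟨hq, hb1, hb2⟩, hj⟩ := hj
    simp only at hq hb1 hb2 hj
    by_contra hne
    obtain ⟨s, hsL, hsd⟩ := hsep _ _ hne
    have hbs : b * L + s < P := by
      have : (b + 1) * L ≤ m * L := Nat.mul_le_mul_right _ hb2
      rw [Nat.succ_mul] at this
      omega
    have htv : j * L + s < v i := by
      have h1 : (q + 1) * P ≤ v i := (Nat.mul_le_mul_right P hq).trans (Nat.div_mul_le_self _ _)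
      have h2 : j * L = q * P + b * L := by rw [← hj, hPm]; ring
      rw [Nat.succ_mul] at h1
      omega
    have hz : ∀ ω' : ℕ → Fin K, zseq L L' (R + 1) g w ph ω' (j * L + s) = g (ω' j) s := by
      intro ω'
      have h2 : j * L + s = (b * L + s) + P * q := by rw [← hj, hPm]; ring
      have h3 : (j * L + s) % P = b * L + s := by
        rw [h2, Nat.add_mul_mod_self_left, Nat.mod_eq_of_lt hbs]
      have h4 : L' * L ≤ b * L := Nat.mul_le_mul_right _ hb1
      have h5 : L' * L = L * L' := Nat.mul_comm _ _
      rw [zseq, ← hP, h3, if_neg (by omega), zF]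
      have h6 : j * L + s = s + L * j := by ring
      rw [h6, Nat.add_mul_mod_self_left, Nat.mod_eq_of_lt hsL,
        Nat.add_mul_div_left _ _ (by omega), Nat.div_eq_of_lt hsL, zero_add]
    have d1 := hi _ htv
    have d2 := hi2 _ htv
    have d3 := hπd ω (j * L + s)
    have d4 := hπd (W i) (j * L + s)
    rw [hz] at d3 d4
    set A := f^[j * L + s] (π ω)
    set B := f^[j * L + s] (π (W i))
    have t1 := dist_triangle4 (g (ω j) s) A B (g (W i j) s)
    have t2 := dist_triangle_left A B (f^[j * L + s] (cc i))
    rw [dist_comm (g (ω j) s) A] at t1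
    linarith)
  refine hcyl.trans ?_
  rw [← ENNReal.tsum_mul_left]
  refine ENNReal.tsum_le_tsum fun i => ?_
  rw [hFcard, ← ENNReal.ofReal_mul (Real.exp_pos _).le, ← Real.exp_add]
  have hKr : (0 : ℝ) < K := by exact_mod_cast hK
  have e1 : (K : ℝ≥0∞)⁻¹ = ENNReal.ofReal ((K : ℝ)⁻¹) := by
    rw [ENNReal.ofReal_inv_of_pos hKr, ENNReal.ofReal_natCast]
  rw [e1, ← ENNReal.ofReal_pow (by positivity)]
  apply ENNReal.ofReal_le_ofReal
  have hv1 : v i < (v i / P + 1) * P := by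
    rw [mul_comm]; exact Nat.lt_mul_div_succ _ hP0
  set V := v i / P
  have hv2 : (v i : ℝ) ≤ (V + 1) * P := by exact_mod_cast hv1.le
  have hKt' : Real.exp (t * P) ≤ (K : ℝ) ^ (R * L') := by
    convert hKt using 3
    rw [hP]; push_cast; ring
  calc ((K : ℝ)⁻¹) ^ (V * (R * L')) = (((K : ℝ) ^ (R * L')) ^ V)⁻¹ := by
        rw [inv_pow, ← pow_mul, mul_comm V]
    _ ≤ ((Real.exp (t * P)) ^ V)⁻¹ := by gcongr
    _ = Real.exp (-(V * (t * P))) := by rw [← Real.exp_nat_mul, Real.exp_neg]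
    _ ≤ Real.exp (t * P + -t * v i) := by
        apply Real.exp_le_exp.2
        nlinarith


theorem abs_sum_le_card_mul {F : ℕ → ℝ} {b : ℝ} (hF : ∀ i, |F i| ≤ b) (n : ℕ) :
    |∑ i ∈ Finset.range n, F i| ≤ n * b := by
  refine (Finset.abs_sum_le_sum_abs _ _).trans ?_
  refine (Finset.sum_le_sum fun t _ => hF t).trans ?_
  simp

/-- Birkhoff sum of a loop against the sum of the inner orbit segment. -/
theorem loop_sum {f : X → X} {Φ : X → ℝ} {b : ℝ} (hb : ∀ x, |Φ x| ≤ b) {a n L M : ℕ} {z : ℕ → X}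
    {x : X} (h1 : a + n ≤ L) (h2 : L ≤ n + 2 * M) (hz : ∀ i < n, z (a + i) = f^[i] x) :
    |∑ i ∈ Finset.range L, Φ (z i) - ∑ i ∈ Finset.range n, Φ (f^[i] x)| ≤ 2 * M * b := by
  obtain ⟨r, rfl⟩ := Nat.exists_eq_add_of_le h1
  have hb0 : 0 ≤ b := (abs_nonneg _).trans (hb x)
  rw [Finset.sum_range_add, Finset.sum_range_add]
  have e1 : ∑ i ∈ Finset.range n, Φ (z (a + i)) = ∑ i ∈ Finset.range n, Φ (f^[i] x) :=
    Finset.sum_congr rfl fun i hi => by rw [hz i (Finset.mem_range.1 hi)]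
  rw [e1]
  have s1 := abs_sum_le_card_mul (F := fun i => Φ (z i)) (fun i => hb _) a
  have s2 := abs_sum_le_card_mul (F := fun i => Φ (z (a + n + i))) (fun i => hb _) r
  have har : (a : ℝ) + r ≤ 2 * M := by
    have : a + r ≤ 2 * M := by omega
    exact_mod_cast this
  have h3 : (a : ℝ) * b + r * b ≤ 2 * M * b := by nlinarith
  rw [abs_le] at *
  constructor <;> linarith [s1.1, s1.2, s2.1, s2.2]

/-- special loops -/
theorem exists_special [CompactSpace X] [MeasurableSpace X] [BorelSpace X]
    {f : X → X} (hf : Continuous f) (p : X)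
    {Φ : X → ℝ} (hΦ : Continuous Φ) (μ : Measure X) [IsProbabilityMeasure μ]
    (hμ : MeasurePreserving f μ μ) (hμY : μ (ChainClassOf f p) = 1)
    {b : ℝ} (hb : ∀ x, |Φ x| ≤ b) {δ κ : ℝ} (hδ : 0 < δ) (hκ : 0 < κ) :
    ∃ (L : ℕ) (w : ℕ → X), 1 ≤ L ∧ w 0 = p ∧ w L = p ∧
      (∀ i < L, dist (f (w i)) (w (i + 1)) < δ) ∧
      L * (∫ x, Φ x ∂μ - κ) ≤ ∑ i ∈ Finset.range L, Φ (w i) := by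
  obtain ⟨M, hM⟩ := exists_loop hf p hδ
  have hb0 : 0 ≤ b := (abs_nonneg _).trans (hb p)
  obtain ⟨n, hn⟩ := exists_nat_gt (4 * M * b / κ)
  have hn' : 4 * M * b < n * κ := by rwa [div_lt_iff₀ hκ] at hn
  have hn1 : 1 ≤ n := by
    rcases Nat.eq_zero_or_pos n with h | h
    · subst h
      have : (0 : ℝ) ≤ 4 * M * b := by positivity
      simp at hn'
      linarith
    · exact h
  obtain ⟨x, hxY, hx⟩ := exists_large_sum (isClosed_chainClassOf hf p) hf hΦ μ hμ hμY n
  obtain ⟨a, L, z, ha, h1, h2, z0, zL, hz, hzx⟩ := hM x hxY n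
  refine ⟨L, z, by omega, z0, zL, hz, ?_⟩
  have hs := loop_sum hb h1 h2 hzx
  have hα : |∫ x, Φ x ∂μ| ≤ b := by
    have := norm_integral_le_of_norm_le_const (μ := μ) (f := Φ) (C := b)
      (Eventually.of_forall fun x => by simpa using hb x)
    simpa using this
  set α := ∫ x, Φ x ∂μ
  have hLn : (n : ℝ) ≤ L := by exact_mod_cast (show n ≤ L by omega)
  have hLM : (L : ℝ) ≤ n + 2 * M := by exact_mod_cast h2
  have hκL : (n : ℝ) * κ ≤ L * κ := by gcongr
  have hq : ((L : ℝ) - n) * α ≤ 2 * M * b := by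
    have hM0 : (0 : ℝ) ≤ M := Nat.cast_nonneg _
    calc ((L : ℝ) - n) * α ≤ (L - n) * b := by
          apply mul_le_mul_of_nonneg_left (le_of_abs_le hα); linarith
      _ ≤ 2 * M * b := by apply mul_le_mul_of_nonneg_right _ hb0; linarith
  rw [abs_le] at hs
  nlinarith [hs.1]

/-- free loops -/
theorem exists_free [CompactSpace X] {f : X → X} (hf : Continuous f) {p : X}
    (hp : p ∈ ChainClassOf f p)
    {Φ : X → ℝ} {b : ℝ} (hb : ∀ x, |Φ x| ≤ b) {δ e ρ t t' : ℝ} (hδ : 0 < δ) (he : 0 < e)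
    (hρ : 0 < ρ) (ht : 0 ≤ t) (htt : t < t')
    (h : ENNReal.ofReal t' < bowenH f (ChainClassOf f p) ρ) :
    ∃ (K L : ℕ) (g : Fin K → ℕ → X) (c : ℝ), 0 < K ∧ 1 ≤ L ∧ (∀ k, g k 0 = p) ∧
      (∀ k, g k L = p) ∧ (∀ k, ∀ i < L, dist (f (g k i)) (g k (i + 1)) < δ) ∧
      (∀ k l, k ≠ l → ∃ i < L, ρ ≤ dist (g k i) (g l i)) ∧
      (∀ k, |∑ i ∈ Finset.range L, Φ (g k i) - L * c| ≤ L * e) ∧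
      Real.exp (L * t) ≤ K := by
  classical
  have : Nonempty X := ⟨p⟩
  obtain ⟨M, hM⟩ := exists_loop hf p hδ
  have hb0 : 0 ≤ b := (abs_nonneg _).trans (hb p)
  obtain ⟨Z, hZ⟩ := exists_nat_gt (b / e + 1)
  set T : Finset (ℕ × ℕ × ℤ) :=
    Finset.range (M + 1) ×ˢ Finset.range (2 * M + 1) ×ˢ Finset.Icc (-(Z : ℤ)) Z with hT
  have hTne : T.Nonempty := ⟨(0, 0, 0), by simp [hT]⟩
  have hT0 : (0 : ℝ) < T.card := by exact_mod_cast hTne.card_pos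
  obtain ⟨n0, hn0⟩ := exists_nat_gt ((2 * M * t + Real.log T.card) / (t' - t))
  obtain ⟨n, hn, E, hEY, hEc, hEs⟩ := exists_separated f (ChainClassOf f p) hρ
    (ht.trans htt.le) h (max n0 1)
  have hn1 : 1 ≤ n := (le_max_right _ _).trans hn
  have hnn0 : (n0 : ℝ) ≤ n := by exact_mod_cast (le_max_left _ _).trans hn
  have hnbig : 2 * M * t + Real.log T.card ≤ n * (t' - t) := by
    rw [div_lt_iff₀ (by linarith)] at hn0
    have : (n0 : ℝ) * (t' - t) ≤ n * (t' - t) := by gcongr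
    linarith
  have hM' : ∀ x : X, ∃ (a L : ℕ) (z : ℕ → X), x ∈ ChainClassOf f p → (a ≤ M ∧ a + n ≤ L ∧
      L ≤ n + 2 * M ∧ z 0 = p ∧ z L = p ∧ (∀ i < L, dist (f (z i)) (z (i + 1)) < δ) ∧
      ∀ i < n, z (a + i) = f^[i] x) := by
    intro x
    by_cases hx : x ∈ ChainClassOf f p
    · obtain ⟨a, L, z, hz⟩ := hM x hx n
      exact ⟨a, L, z, fun _ => hz⟩
    · exact ⟨0, 0, fun _ => p, fun h => absurd h hx⟩
  choose a L z hz using hM'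
  set bin : X → ℤ := fun x => ⌊(∑ i ∈ Finset.range (L x), Φ (z x i)) / L x / e⌋ with hbin
  have hmaps : ∀ x ∈ E, (a x, L x - n, bin x) ∈ T := by
    intro x hx
    obtain ⟨h1, h2, h3, -⟩ := hz x (hEY x hx)
    have hL0 : (0 : ℝ) < L x := by exact_mod_cast (show 0 < L x by omega)
    simp only [hT, Finset.mem_product, Finset.mem_range, Finset.mem_Icc]
    refine ⟨by omega, by omega, ?_⟩
    have hs := abs_sum_le_card_mul (F := fun i => Φ (z x i)) (fun i => hb _) (L x)
    have hs2 : |(∑ i ∈ Finset.range (L x), Φ (z x i)) / L x / e| ≤ b / e := by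
      rw [abs_div, abs_div, abs_of_pos he, abs_of_pos hL0]
      gcongr
      rw [div_le_iff₀ hL0, mul_comm]; exact hs
    rw [abs_le] at hs2
    simp only [hbin]
    constructor
    · rw [Int.le_floor]; push_cast; linarith
    · have h5 := Int.floor_le ((∑ i ∈ Finset.range (L x), Φ (z x i)) / L x / e)
      have h6 : ((⌊(∑ i ∈ Finset.range (L x), Φ (z x i)) / L x / e⌋ : ℤ) : ℝ) ≤ (Z : ℤ) := by
        push_cast; linarith
      exact_mod_cast h6
  obtain ⟨⟨a0, l0, b0⟩, -, hcard⟩ := Finset.exists_le_card_fiber_of_nsmul_le_card_of_maps_to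
    (s := E) (t := T) (f := fun x => (a x, L x - n, bin x)) (b := (E.card : ℝ) / T.card)
    hmaps hTne (by rw [nsmul_eq_mul]; field_simp; rfl)
  set G := E.filter (fun x => (a x, L x - n, bin x) = (a0, l0, b0)) with hG
  have hGm : ∀ x ∈ G, x ∈ E ∧ a x = a0 ∧ L x = n + l0 ∧ bin x = b0 := by
    intro x hx
    rw [hG, Finset.mem_filter, Prod.mk.injEq, Prod.mk.injEq] at hx
    obtain ⟨h0, h1, h2, h3⟩ := hx
    obtain ⟨_, h5, _⟩ := hz x (hEY x h0)
    exact ⟨h0, h1, by omega, h3⟩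
  have hEpos : (0 : ℝ) < E.card := lt_of_lt_of_le (Real.exp_pos _) hEc
  have hGpos : 0 < G.card := by
    have : (0 : ℝ) < G.card := lt_of_lt_of_le (by positivity) hcard
    exact_mod_cast this
  obtain ⟨x0, hx0⟩ := Finset.card_pos.1 hGpos
  have hl0 : l0 ≤ 2 * M := by
    obtain ⟨h0, h1, h2, h3⟩ := hGm x0 hx0
    obtain ⟨_, _, h6, _⟩ := hz x0 (hEY x0 h0)
    omega
  set y : Fin G.card → X := fun k => (G.equivFin.symm k : X) with hy
  have hyG : ∀ k, y k ∈ G := fun k => (G.equivFin.symm k).2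
  have hyinj : ∀ k l, k ≠ l → y k ≠ y l := by
    intro k l hkl hkl'
    exact hkl (G.equivFin.symm.injective (Subtype.ext hkl'))
  refine ⟨G.card, n + l0, fun k => z (y k), b0 * e, hGpos, by omega, ?_, ?_, ?_, ?_, ?_, ?_⟩
  · intro k
    obtain ⟨h0, h1, h2, h3⟩ := hGm _ (hyG k)
    exact (hz _ (hEY _ h0)).2.2.2.1
  · intro k
    obtain ⟨h0, h1, h2, h3⟩ := hGm _ (hyG k)
    rw [← h2]
    exact (hz _ (hEY _ h0)).2.2.2.2.1
  · intro k
    obtain ⟨h0, h1, h2, h3⟩ := hGm _ (hyG k)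
    rw [← h2]
    exact (hz _ (hEY _ h0)).2.2.2.2.2.1
  · intro k l hkl
    obtain ⟨h0, h1, h2, h3⟩ := hGm _ (hyG k)
    obtain ⟨h0', h1', h2', h3'⟩ := hGm _ (hyG l)
    obtain ⟨i, hi, hd⟩ := hEs _ h0 _ h0' (hyinj k l hkl)
    obtain ⟨q1, q2, q3, q4, q5, q6, q7⟩ := hz _ (hEY _ h0)
    obtain ⟨r1, r2, r3, r4, r5, r6, r7⟩ := hz _ (hEY _ h0')
    refine ⟨a0 + i, by omega, ?_⟩
    have u1 := q7 i hi
    have u2 := r7 i hi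
    rw [h1] at u1
    rw [h1'] at u2
    show ρ ≤ dist (z (y k) (a0 + i)) (z (y l) (a0 + i))
    rw [u1, u2]
    exact hd
  · intro k
    obtain ⟨h0, h1, h2, h3⟩ := hGm _ (hyG k)
    have hL0 : (0 : ℝ) < ((n + l0 : ℕ) : ℝ) := by exact_mod_cast (show 0 < n + l0 by omega)
    simp only [hbin, h2] at h3
    set S := ∑ i ∈ Finset.range (n + l0), Φ (z (y k) i)
    set N : ℝ := ((n + l0 : ℕ) : ℝ)
    have f1 := Int.floor_le (S / N / e)
    have f2 := Int.lt_floor_add_one (S / N / e)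
    rw [h3, le_div_iff₀ he, le_div_iff₀ hL0] at f1
    rw [h3, div_lt_iff₀ he, div_lt_iff₀ hL0] at f2
    rw [abs_le]
    constructor <;> nlinarith
  · have h1 : Real.exp (n * t' - Real.log T.card) ≤ G.card := by
      rw [Real.exp_sub, Real.exp_log hT0]
      refine le_trans ?_ hcard
      gcongr
    refine le_trans (Real.exp_le_exp.2 ?_) h1
    have h2 : (l0 : ℝ) ≤ 2 * M := by exact_mod_cast hl0
    push_cast
    nlinarith

theorem main_ineq [CompactSpace X] [MeasurableSpace X] [BorelSpace X]
    {f : X → X} (hf : Continuous f) (hsh : ShadowingProperty f) {p : X}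
    (hp : p ∈ ChainClassOf f p) {r : ℝ} (hr : 0 < r)
    (hiso : Metric.thickening r (ChainClassOf f p) ∩ ChainRecurrent f = ChainClassOf f p)
    {Φ : X → ℝ} (hΦ : Continuous Φ) (μ₁ μ₂ : Measure X)
    [IsProbabilityMeasure μ₁] [IsProbabilityMeasure μ₂]
    (h₁e : MeasurePreserving f μ₁ μ₁) (h₂e : MeasurePreserving f μ₂ μ₂)
    (h₁Y : μ₁ (ChainClassOf f p) = 1) (h₂Y : μ₂ (ChainClassOf f p) = 1)
    (hlt : ∫ x, Φ x ∂μ₂ < ∫ x, Φ x ∂μ₁) {ε : ℝ} (hε : 0 < ε) :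
    bowenH f (ChainClassOf f p) (4 * ε) ≤ bowenH f (IrregularSet f Φ ∩ ChainClassOf f p) ε := by
  refine le_of_forall_lt fun s hs => ?_
  obtain ⟨t, ht0, hst, ht⟩ := ENNReal.lt_iff_exists_real_btwn.1 hs
  refine hst.trans_le ?_
  obtain ⟨t2, ht20, htt2, ht2⟩ := ENNReal.lt_iff_exists_real_btwn.1 ht
  have ht2' : t < t2 := by
    by_contra! h'
    exact absurd (ENNReal.ofReal_le_ofReal h') (not_le.2 htt2)
  set t1 := (t + t2) / 2 with ht1
  have h01 : t < t1 := by rw [ht1]; linarith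
  have h12 : t1 < t2 := by rw [ht1]; linarith
  set α₁ := ∫ x, Φ x ∂μ₁ with hα₁
  set α₂ := ∫ x, Φ x ∂μ₂ with hα₂
  set Δ := α₁ - α₂ with hΔ
  have hΔ0 : 0 < Δ := by rw [hΔ]; linarith
  obtain ⟨R, hR⟩ := exists_nat_gt (t / (t1 - t))
  have hRt : t * (R + 1) ≤ t1 * R := by
    rw [div_lt_iff₀ (by linarith)] at hR
    nlinarith
  set e := Δ / (160 * (R + 1)) with he
  have he0 : 0 < e := by positivity
  have heR : (R + 1) * (4 * e) = Δ / 40 := by rw [he]; field_simp; norm_num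
  obtain ⟨ρ, hρ, hρΦ⟩ := Metric.uniformContinuous_iff.1
    (CompactSpace.uniformContinuous_of_continuous hΦ) e he0
  set ε' := min ε ρ with hε'
  have hε'0 : 0 < ε' := by positivity
  obtain ⟨δ, hδ, hshY⟩ := class_shadowing hf hsh hr hiso hp hε'0
  obtain ⟨b, hb⟩ : ∃ b : ℝ, ∀ x, |Φ x| ≤ b := by
    obtain ⟨b, hb⟩ := (isCompact_range hΦ).isBounded.exists_norm_le
    exact ⟨b, fun x => hb _ ⟨x, rfl⟩⟩
  obtain ⟨K, L, g, c, hK, hL, g0, gL, hg, hsep, hgs, hKL⟩ :=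
    exists_free hf hp hb hδ he0 (by linarith : 0 < 4 * ε) (ht0.trans h01.le) h12 ht2
  have fin : ∀ (L' : ℕ) (w : ℕ → X), 1 ≤ L' → w 0 = p → w L' = p →
      (∀ i < L', dist (f (w i)) (w (i + 1)) < δ) →
      Δ / 4 ≤ |(∑ i ∈ Finset.range L', Φ (w i)) / L' - c| →
      ENNReal.ofReal t ≤ bowenH f (IrregularSet f Φ ∩ ChainClassOf f p) ε := by
    intro L' w hL' w0 wL hw hD
    have hL'0 : (0 : ℝ) < L' := by exact_mod_cast hL'
    refine core_bound (R := R) (D := (∑ i ∈ Finset.range L', Φ (w i)) / L' - c) hK hL hL' he0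
      (min_le_left _ _) ht0 hshY ?_ g0 gL hg hsep hgs w0 wL hw ?_ ?_ ?_
    · intro x y hxy
      have := hρΦ (lt_of_lt_of_le hxy (min_le_right _ _))
      rw [Real.dist_eq] at this
      exact this.le
    · field_simp; ring
    · rw [heR]; linarith
    · calc Real.exp (t * ((R + 1) * (L * L')))
          ≤ Real.exp ((R * L' : ℕ) * (L * t1)) := by
            apply Real.exp_le_exp.2
            push_cast
            have : (0 : ℝ) ≤ L * L' := by positivity
            nlinarith
        _ = Real.exp (L * t1) ^ (R * L') := Real.exp_nat_mul _ _
        _ ≤ (K : ℝ) ^ (R * L') := by gcongr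
  obtain ⟨L1, w1, hL1, w10, w1L, hw1, hs1⟩ := exists_special hf p hΦ μ₁ h₁e h₁Y hb hδ
    (show 0 < Δ / 4 by linarith)
  obtain ⟨L2, w2, hL2, w20, w2L, hw2, hs2⟩ := exists_special (Φ := fun x => -Φ x) hf p hΦ.neg
    μ₂ h₂e h₂Y (b := b) (fun x => by rw [abs_neg]; exact hb x) hδ (show 0 < Δ / 4 by linarith)
  rw [integral_neg, Finset.sum_neg_distrib] at hs2
  have hL10 : (0 : ℝ) < L1 := by exact_mod_cast hL1
  have hL20 : (0 : ℝ) < L2 := by exact_mod_cast hL2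
  have q1 : α₁ - Δ / 4 ≤ (∑ i ∈ Finset.range L1, Φ (w1 i)) / L1 := by
    rw [le_div_iff₀ hL10]; linarith
  have q2 : (∑ i ∈ Finset.range L2, Φ (w2 i)) / L2 ≤ α₂ + Δ / 4 := by
    rw [div_le_iff₀ hL20]; linarith
  rcases le_total c ((α₁ + α₂) / 2) with hc | hc
  · exact fin L1 w1 hL1 w10 w1L hw1 (le_trans (by linarith) (le_abs_self _))
  · exact fin L2 w2 hL2 w20 w2L hw2 (le_trans (by linarith) (neg_le_abs _))

/-- Corollary: for an isolated chain recurrent class, the irregular set inside the class has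
full Bowen entropy and full relative metric mean dimensions of the class. -/
theorem irregular_set_isolated_class [CompactSpace X]
    [MeasurableSpace X] [BorelSpace X]
    (f : X → X) (hf : Continuous f) (hsh : ShadowingProperty f)
    (Y : Set X) (hY : IsChainClass f Y)
    (hiso : ∃ ε : ℝ, 0 < ε ∧ Metric.thickening ε Y ∩ ChainRecurrent f = Y)
    (Φ : X → ℝ) (hΦ : Continuous Φ)
    (μ₁ μ₂ : Measure X)
    (h₁p : IsProbabilityMeasure μ₁) (h₂p : IsProbabilityMeasure μ₂)
    (h₁e : Ergodic f μ₁) (h₂e : Ergodic f μ₂)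
    (h₁Y : μ₁ Y = 1) (h₂Y : μ₂ Y = 1)
    (hne : ∫ x, Φ x ∂μ₁ ≠ ∫ x, Φ x ∂μ₂) :
    bowenEntropy f (IrregularSet f Φ ∩ Y) = bowenEntropy f Y ∧
    lowerMdim f (IrregularSet f Φ ∩ Y) = lowerMdim f Y ∧
    upperMdim f (IrregularSet f Φ ∩ Y) = upperMdim f Y := by
  obtain ⟨p, hpc, rfl⟩ := hY
  obtain ⟨r, hr, hiso⟩ := hiso
  have hpp : p ∈ ChainClassOf f p :=
    mem_chainClassOf_iff.2 ⟨mem_chainRecurrent_iff.1 hpc, mem_chainRecurrent_iff.1 hpc⟩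
  have key : ∀ ε : ℝ, 0 < ε → bowenH f (ChainClassOf f p) (4 * ε) ≤
      bowenH f (IrregularSet f Φ ∩ ChainClassOf f p) ε := by
    intro ε hε
    rcases lt_or_gt_of_ne hne with h | h
    · exact main_ineq hf hsh hpp hr hiso hΦ μ₂ μ₁ h₂e.toMeasurePreserving
        h₁e.toMeasurePreserving h₂Y h₁Y h hε
    · exact main_ineq hf hsh hpp hr hiso hΦ μ₁ μ₂ h₁e.toMeasurePreserving
        h₂e.toMeasurePreserving h₁Y h₂Y h hε
  have mono : ∀ ε : ℝ, bowenH f (IrregularSet f Φ ∩ ChainClassOf f p) ε ≤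
      bowenH f (ChainClassOf f p) ε := fun ε => bowenH_mono_set f Set.inter_subset_right ε
  refine ⟨le_antisymm ?_ ?_, le_antisymm ?_ ?_, le_antisymm ?_ ?_⟩
  · exact iSup₂_mono fun ε _ => mono ε
  · refine iSup₂_le fun ε hε => ?_
    have h1 := key (ε / 4) (by linarith)
    rw [show 4 * (ε / 4) = ε by ring] at h1
    exact h1.trans (le_iSup₂ (f := fun (ε : ℝ) (_ : 0 < ε) =>
      bowenH f (IrregularSet f Φ ∩ ChainClassOf f p) ε) (ε / 4) (by linarith))
  · exact liminf_le_liminf (Eventually.of_forall fun ε => ENNReal.div_le_div_right (mono ε) _)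
  · exact scale_liminf _ _ key
  · exact limsup_le_limsup (Eventually.of_forall fun ε => ENNReal.div_le_div_right (mono ε) _)
  · exact scale_limsup _ _ key
end

section
/- If f : X → X is a transitive map with the shadowing property on a compact metric space with positive topological entropy, then there exist a continuous Φ : X → ℝ and ergodic invariant measures μ_1 ≠ μ_2 with ∫Φ dμ_1 ≠ ∫Φ dμ_2; consequently the irregular set I_Φ(f) is nonempty and X is the unique chain recurrent class. -/
open Filter Topology MeasureTheory Set
open scoped ENNReal NNReal

variable {X : Type*} [MetricSpace X]

section ErgodicExistence
variable {Y : Type*} [MetricSpace Y] [CompactSpace Y] [MeasurableSpace Y] [BorelSpace Y]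

/-- Krylov-Bogoliubov. -/
lemma kb_exists_invariant [Nonempty Y] (g : Y → Y) (hg : Continuous g) :
    ∃ μ : ProbabilityMeasure Y, MeasurePreserving g (μ : Measure Y) (μ : Measure Y) := by
  obtain ⟨x⟩ := ‹Nonempty Y›
  let m : ℕ → Measure Y := fun n =>
    ((n + 1 : ℕ) : ℝ≥0∞)⁻¹ • ∑ i ∈ Finset.range (n + 1), Measure.dirac (g^[i] x)
  have hm : ∀ n, IsProbabilityMeasure (m n) := by
    intro n
    constructor
    simp only [m, Measure.smul_apply, Measure.coe_finsetSum, Finset.sum_apply, measure_univ,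
      Finset.sum_const, Finset.card_range, smul_eq_mul, nsmul_eq_mul, mul_one]
    exact ENNReal.inv_mul_cancel (by simp) (by simp)
  let ν : ℕ → ProbabilityMeasure Y := fun n => ⟨m n, hm n⟩
  have hintg : ∀ (h : BoundedContinuousFunction Y ℝ) n,
      ∫ y, h y ∂(ν n : Measure Y) = ((n + 1 : ℕ) : ℝ)⁻¹ * ∑ i ∈ Finset.range (n + 1), h (g^[i] x) := by
    intro h n
    change ∫ y, h y ∂(m n) = _
    simp only [m]
    rw [integral_smul_measure, integral_finsetSum_measure]
    · simp [ENNReal.toReal_add]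
    · intro i _
      exact h.integrable _
  let U : Ultrafilter (ProbabilityMeasure Y) := (Filter.hyperfilter ℕ).map ν
  obtain ⟨μ, -, hμ⟩ := isCompact_univ.ultrafilter_le_nhds U (by simp)
  have hlim : Tendsto ν (Filter.hyperfilter ℕ : Filter ℕ) (𝓝 μ) := hμ
  refine ⟨μ, hg.measurable, ?_⟩
  have : IsProbabilityMeasure ((μ : Measure Y).map g) :=
    Measure.isProbabilityMeasure_map hg.measurable.aemeasurable
  apply ext_of_forall_integral_eq_of_IsFiniteMeasure
  intro h
  rw [integral_map hg.measurable.aemeasurable h.continuous.aestronglyMeasurable]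
  have h1 := (ProbabilityMeasure.tendsto_iff_forall_integral_tendsto.1 hlim) h
  have h2 := (ProbabilityMeasure.tendsto_iff_forall_integral_tendsto.1 hlim)
    (h.compContinuous ⟨g, hg⟩)
  have h3 : Tendsto (fun n => ∫ y, (h.compContinuous ⟨g, hg⟩) y ∂(ν n : Measure Y)
      - ∫ y, h y ∂(ν n : Measure Y)) atTop (𝓝 0) := by
    have hb : Tendsto (fun n : ℕ => ((n + 1 : ℕ) : ℝ)⁻¹ * (2 * ‖h‖)) atTop (𝓝 0) := by
      have := (tendsto_inv_atTop_nhds_zero_nat (𝕜 := ℝ)).comp (tendsto_add_atTop_nat 1)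
      simpa [Function.comp_def] using this.mul_const (2 * ‖h‖)
    refine squeeze_zero_norm (fun n => ?_) hb
    rw [hintg, hintg, ← mul_sub, ← Finset.sum_sub_distrib]
    have : ∀ i, (h.compContinuous ⟨g, hg⟩) (g^[i] x) - h (g^[i] x)
        = h (g^[i+1] x) - h (g^[i] x) := by
      intro i
      simp [Function.iterate_succ_apply']
    simp only [this]
    rw [Finset.sum_range_sub (fun i => h (g^[i] x)), norm_mul]
    have e1 := h.norm_coe_le_norm (g^[n+1] x)
    have e2 := h.norm_coe_le_norm (g^[0] x)
    have e3 := norm_sub_le (h (g^[n+1] x)) (h (g^[0] x))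
    have e4 : ‖(((n + 1 : ℕ) : ℝ)⁻¹)‖ = ((n + 1 : ℕ) : ℝ)⁻¹ := by
      rw [Real.norm_eq_abs, abs_of_nonneg]; positivity
    rw [e4]
    gcongr
    linarith
  have h4 := tendsto_nhds_unique (h2.sub h1) (h3.mono_left Nat.hyperfilter_le_atTop)
  have := sub_eq_zero.1 h4
  simpa using this

lemma kb_exists_ergodic [Nonempty Y] (g : Y → Y) (hg : Continuous g) :
    ∃ μ : Measure Y, IsProbabilityMeasure μ ∧ Ergodic g μ := by
  let ι : ProbabilityMeasure Y → (BoundedContinuousFunction Y ℝ → ℝ) :=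
    fun μ h => ∫ y, h y ∂(μ : Measure Y)
  have hι : Continuous ι := by
    rw [continuous_iff_continuousAt]
    intro μ
    refine tendsto_pi_nhds.2 fun h => ?_
    exact (ProbabilityMeasure.tendsto_iff_forall_integral_tendsto.1 tendsto_id) h
  have hinj : ∀ μ ν, ι μ = ι ν → μ = ν := by
    intro μ ν h
    apply Subtype.ext
    exact ext_of_forall_integral_eq_of_IsFiniteMeasure (μ := (μ : Measure Y)) (ν := (ν : Measure Y))
      (fun k => congrFun h k)
  let I : Set (ProbabilityMeasure Y) :=
    {μ | ∀ h : BoundedContinuousFunction Y ℝ, ι μ (h.compContinuous ⟨g, hg⟩) = ι μ h}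
  have hI : IsClosed I := by
    simp only [I, ofPred_forall]
    refine isClosed_iInter fun h => ?_
    have hk : ∀ k : BoundedContinuousFunction Y ℝ, Continuous (fun μ => ι μ k) :=
      fun k => (continuous_apply k).comp hι
    exact isClosed_eq (hk _) (hk _)
  have hIm : ∀ μ : ProbabilityMeasure Y,
      μ ∈ I ↔ MeasurePreserving g (μ : Measure Y) (μ : Measure Y) := by
    intro μ
    constructor
    · intro h
      refine ⟨hg.measurable, ?_⟩
      have : IsProbabilityMeasure ((μ : Measure Y).map g) :=
        Measure.isProbabilityMeasure_map hg.measurable.aemeasurable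
      apply ext_of_forall_integral_eq_of_IsFiniteMeasure
      intro k
      rw [integral_map hg.measurable.aemeasurable k.continuous.aestronglyMeasurable]
      exact h k
    · intro h k
      have := integral_map (μ := (μ : Measure Y)) hg.measurable.aemeasurable
        (k.continuous.aestronglyMeasurable (μ := (μ : Measure Y).map g))
      rw [h.map_eq] at this
      exact this.symm
  obtain ⟨μ₀, hμ₀⟩ := kb_exists_invariant g hg
  obtain ⟨e, he⟩ := (hI.isCompact.image hι).extremePoints_nonempty
    ⟨_, mem_image_of_mem ι ((hIm μ₀).2 hμ₀)⟩
  obtain ⟨μ, hμI, rfl⟩ := he.1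
  refine ⟨μ, inferInstance, Ergodic.of_mem_extremePoints ?_⟩
  rw [mem_extremePoints_iff_left]
  refine ⟨⟨(hIm μ).1 hμI, inferInstance⟩, ?_⟩
  rintro ν₁ ⟨h1, p1⟩ ν₂ ⟨h2, p2⟩ ⟨a, b, ha, hb, hab, hμ⟩
  have hat : a ≠ ∞ := fun h => by simp [h] at hab
  have hbt : b ≠ ∞ := fun h => by simp [h] at hab
  have key := (mem_extremePoints_iff_left.1 he).2 (ι ⟨ν₁, p1⟩) (mem_image_of_mem ι ((hIm _).2 h1))
    (ι ⟨ν₂, p2⟩) (mem_image_of_mem ι ((hIm _).2 h2)) ⟨a.toReal, b.toReal,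
      ENNReal.toReal_pos ha.ne' hat, ENNReal.toReal_pos hb.ne' hbt, by
        rw [← ENNReal.toReal_add hat hbt, hab]; simp, by
        funext k
        simp only [ι, Pi.add_apply, Pi.smul_apply, smul_eq_mul, ProbabilityMeasure.coe_mk]
        rw [← hμ, integral_add_measure, integral_smul_measure, integral_smul_measure]
        · rfl
        · exact (k.integrable _).smul_measure hat
        · exact (k.integrable _).smul_measure hbt⟩
  have := hinj _ _ key
  exact congrArg Subtype.val this

lemma kb_exists_ergodic_on (g : Y → Y) (hg : Continuous g) (W : Set Y) (hW : IsClosed W)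
    (hne : W.Nonempty) (hmaps : MapsTo g W W) :
    ∃ μ : Measure Y, IsProbabilityMeasure μ ∧ Ergodic g μ ∧ μ Wᶜ = 0 := by
  have : CompactSpace W := isCompact_iff_compactSpace.1 hW.isCompact
  have : Nonempty W := hne.to_subtype
  have hgc : Continuous (hmaps.restrict g W W) := hg.restrict hmaps
  obtain ⟨μ, hp, herg⟩ := kb_exists_ergodic (hmaps.restrict g W W) hgc
  have hv : Measurable (Subtype.val : W → Y) := measurable_subtype_coe
  refine ⟨μ.map Subtype.val, Measure.isProbabilityMeasure_map hv.aemeasurable, ?_, ?_⟩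
  · refine ⟨⟨hg.measurable, ?_⟩, ⟨?_⟩⟩
    · rw [Measure.map_map hg.measurable hv]
      have : g ∘ (Subtype.val : W → Y) = Subtype.val ∘ hmaps.restrict g W W := by
        funext w; rfl
      rw [this, ← Measure.map_map hv hgc.measurable, herg.map_eq]
    · intro s hs hinv
      have h1 : (hmaps.restrict g W W) ⁻¹' (Subtype.val ⁻¹' s) = (Subtype.val ⁻¹' s : Set W) := by
        ext w
        have : g w ∈ s ↔ (w : Y) ∈ s := by
          conv_rhs => rw [← hinv]
          rfl
        exact this
      have h2 := herg.prob_eq_zero_or_one (hv hs) h1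
      have h3 : IsProbabilityMeasure (μ.map (Subtype.val : W → Y)) :=
        Measure.isProbabilityMeasure_map hv.aemeasurable
      rw [← Measure.map_apply hv hs] at h2
      rw [eventuallyConst_set']
      rcases h2 with h2 | h2
      · left; exact ae_eq_empty.2 h2
      · right
        exact (ae_eq_univ_iff_measure_eq hs.nullMeasurableSet).2 (by rw [h2, measure_univ])
  · rw [Measure.map_apply hv hW.measurableSet.compl]
    simp
end ErgodicExistence

lemma entropy_zero_of_equicontinuous [CompactSpace X] [Nonempty X] (f : X → X)
    (heq : ∀ ε > 0, ∃ δ > 0, ∀ u v : X, dist u v < δ → ∀ n, dist (f^[n] u) (f^[n] v) < ε) :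
    bowenEntropy f (Set.univ : Set X) = 0 := by
  unfold bowenEntropy
  refine le_antisymm (iSup₂_le fun ε hε => ?_) bot_le
  have hC : ∀ t : ℝ, 0 < t → bowenCLim f (univ : Set X) t ε = 0 := by
    intro t ht
    refine le_antisymm (iSup_le fun n => ?_) bot_le
    obtain ⟨δ, hδ, h⟩ := heq ε hε
    let F : ℕ → ℝ≥0∞ := fun i => ENNReal.ofReal (Real.exp (-t * (i : ℕ)))
    have hF : ∑' i, F i ≠ ∞ := by
      have hs : Summable (fun i : ℕ => Real.exp (-t * (i : ℕ))) := by
        have h1 : ∀ i : ℕ, Real.exp (-t * (i : ℕ)) = (Real.exp (-t)) ^ i := by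
          intro i
          rw [← Real.exp_nat_mul, mul_comm]
        simp only [h1]
        exact summable_geometric_of_lt_one (Real.exp_pos _).le (by
          rw [Real.exp_lt_one_iff]; linarith)
      exact hs.tsum_ofReal_ne_top
    have hlim := ENNReal.tendsto_sum_nat_add F hF
    have hle : ∀ m, n ≤ m → bowenC f (univ : Set X) t ε n ≤ ∑' k, F (k + m) := by
      intro m hm
      unfold bowenC
      refine iInf_le_of_le (TopologicalSpace.denseSeq X) (iInf_le_of_le (fun i => i + m)
        (iInf_le_of_le (fun i => by show n ≤ i + m; omega) (iInf_le_of_le ?_ ?_)))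
      · intro y _
        obtain ⟨i, hi⟩ := (TopologicalSpace.denseRange_denseSeq X).exists_dist_lt y hδ
        refine mem_iUnion.2 ⟨i, fun j _ => ?_⟩
        exact h _ _ (by rwa [dist_comm]) j
      · exact le_of_eq rfl
    exact ge_of_tendsto hlim (eventually_atTop.2 ⟨n, hle⟩)
  unfold bowenH
  refine le_of_forall_gt fun c hc => ?_
  obtain ⟨r, hr0, hrc⟩ := ENNReal.lt_iff_exists_real_btwn.1 hc
  obtain ⟨hr, hrc⟩ := hrc
  refine lt_of_le_of_lt (sInf_le ⟨r, hC r ?_, rfl⟩) hrc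
  by_contra hneg
  rw [ENNReal.ofReal_of_nonpos (not_lt.1 hneg)] at hr
  exact absurd hr (by simp)

/-- A point with dense, non-recurrent orbit forces equicontinuity. -/
lemma equicontinuous_of_not_recurrent (f : X → X) (x : X)
    (hx : Dense (Set.range fun n => f^[n] x)) (hsh : ShadowingProperty f)
    (hnr : ¬ Dense (Set.range fun n => f^[n+1] x)) :
    ∀ ε > 0, ∃ δ > 0, ∀ u v : X, dist u v < δ → ∀ n, dist (f^[n] u) (f^[n] v) < ε := by
  have hrange : (Set.range fun n => f^[n] x) = {x} ∪ Set.range fun n => f^[n+1] x := by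
    ext y
    constructor
    · rintro ⟨n, rfl⟩
      rcases n with _ | n
      · left; simp
      · right; exact ⟨n, rfl⟩
    · rintro (h | ⟨n, rfl⟩)
      · exact ⟨0, by simpa using h.symm⟩
      · exact ⟨n + 1, rfl⟩
  have hcl : ∀ y, y = x ∨ y ∈ closure (Set.range fun n => f^[n+1] x) := by
    intro y
    have := hx y
    rw [hrange, closure_union, closure_singleton] at this
    exact this
  have hxn : x ∉ closure (Set.range fun n => f^[n+1] x) := by
    intro h
    apply hnr
    intro y
    rcases hcl y with rfl | h'
    · exact h
    · exact h'
  obtain ⟨ε₁, hε₁, hball⟩ := Metric.isOpen_iff.1 isClosed_closure.isOpen_compl x hxn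
  have hiso : ∀ y, dist y x < ε₁ → y = x := by
    intro y hy
    rcases hcl y with h | h
    · exact h
    · exact absurd h (hball hy)
  intro ε hε
  obtain ⟨δ, hδ, hs⟩ := hsh (min (ε/2) ε₁) (by positivity)
  have key : ∀ k w, dist (f^[k+1] x) w < δ → ∀ n, dist (f^[k+1+n] x) (f^[n] w) < ε / 2 := by
    intro k w hw n
    obtain ⟨y, hy⟩ := hs (fun i => if i ≤ k then f^[i] x else f^[i - (k+1)] w) (by
      intro i
      rcases lt_trichotomy i k with h | h | h
      · have h1 : i ≤ k := h.le
        have h2 : i + 1 ≤ k := h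
        simp only [h1, h2, if_true, ← Function.iterate_succ_apply' f, dist_self]
        exact hδ
      · subst h
        simpa [← Function.iterate_succ_apply' f] using hw
      · have h1 : ¬ i ≤ k := by omega
        have h2 : ¬ i + 1 ≤ k := by omega
        have h3 : i + 1 - (k + 1) = (i - (k+1)) + 1 := by omega
        simp only [h1, h2, if_false, h3, Function.iterate_succ_apply' f, dist_self]
        exact hδ)
    have hyx : y = x := by
      apply hiso
      have := hy 0
      simp only [Function.iterate_zero, id, zero_le, if_true] at this
      exact this.trans_le (min_le_right _ _)
    have := hy (k + 1 + n)
    have h1 : ¬ (k + 1 + n ≤ k) := by omega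
    have h2 : k + 1 + n - (k + 1) = n := by omega
    rw [hyx] at this
    simp only [h1, h2, if_false] at this
    exact this.trans_le (min_le_left _ _)
  refine ⟨min (δ/2) ε₁, by positivity, fun u v huv n => ?_⟩
  have huv1 : dist u v < δ / 2 := huv.trans_le (min_le_left _ _)
  have huv2 : dist u v < ε₁ := huv.trans_le (min_le_right _ _)
  rcases hcl u with rfl | hu
  · rw [dist_comm] at huv2
    rw [hiso v huv2, dist_self]; exact hε
  · obtain ⟨_, ⟨k, rfl⟩, hk⟩ := Metric.mem_closure_iff.1 hu (δ/2) (by positivity)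
    have h1 := key k u (by rw [dist_comm]; linarith) n
    have h2 := key k v (by
      have := dist_triangle (f^[k+1] x) u v
      rw [dist_comm (f^[k+1] x) u] at this
      simp only at hk
      linarith) n
    have := dist_triangle_left (f^[n] u) (f^[n] v) (f^[k+1+n] x)
    linarith

/-- One-step chains. -/
lemma exists_chain_of_recurrent [CompactSpace X] (f : X → X) (hf : Continuous f) (x : X)
    (hr : Dense (Set.range fun n => f^[n+1] x)) (δ : ℝ) (hδ : 0 < δ) (u v : X) :
    ∃ (n : ℕ) (c : ℕ → X), 1 ≤ n ∧ c 0 = u ∧ c n = v ∧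
      ∀ i < n, dist (f (c i)) (c (i + 1)) < δ := by
  have hsurj : Function.Surjective f := by
    have hc : IsClosed (Set.range f) := (isCompact_range hf).isClosed
    have hsub : (Set.range fun n => f^[n+1] x) ⊆ Set.range f := by
      rintro _ ⟨n, rfl⟩
      exact ⟨f^[n] x, (Function.iterate_succ_apply' f n x).symm⟩
    intro y
    have := closure_minimal hsub hc (hr y)
    exact this
  obtain ⟨_, ⟨k, rfl⟩, hk⟩ := Metric.mem_closure_iff.1 (hr (f u)) δ hδ
  have hdk : DenseRange (f^[k+1] ∘ fun n => f^[n+1] x) :=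
    DenseRange.comp ((hsurj.iterate (k+1)).denseRange) hr (hf.iterate _)
  obtain ⟨_, ⟨m, rfl⟩, hm⟩ := Metric.mem_closure_iff.1 (hdk v) δ hδ
  simp only [Function.comp_apply, ← Function.iterate_add_apply] at hm hk
  -- the chain is u, f^(k+1) x, ..., f^(k+1+m) x, v
  refine ⟨m + 2, fun i => if i = 0 then u else if i = m + 2 then v else f^[k + i] x, by omega,
    by simp, by simp, fun i hi => ?_⟩
  rcases Nat.eq_zero_or_pos i with rfl | hi0
  · have h1 : ¬ (0 + 1 = m + 2) := by omega
    simp only [h1, if_true, if_false]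
    simpa using hk
  · have h1 : i ≠ 0 := by omega
    have h2 : i ≠ m + 2 := by omega
    have h3 : i + 1 ≠ 0 := by omega
    simp only [h1, h2, h3, if_false, ← Function.iterate_succ_apply' f]
    by_cases h4 : i + 1 = m + 2
    · simp only [h4, if_true]
      have h5 : (k + i).succ = k + 1 + (m + 1) := by omega
      rw [h5, dist_comm]
      exact hm
    · simp only [h4, if_false]
      have h5 : (k + i).succ = k + (i + 1) := by omega
      rw [h5, dist_self]
      exact hδ

/-- A loop through a point following its orbit for time `n`. -/
lemma exists_loop_s19 (f : X → X) (δ : ℝ) (hδ : 0 < δ)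
    (hch : ∀ u v : X, ∃ (n : ℕ) (c : ℕ → X), 1 ≤ n ∧ c 0 = u ∧ c n = v ∧
      ∀ i < n, dist (f (c i)) (c (i + 1)) < δ) (u : X) (n : ℕ) :
    ∃ (p : ℕ) (α : ℕ → X), n < p ∧ α 0 = u ∧ α n = f^[n] u ∧ α p = u ∧
      ∀ i < p, dist (f (α i)) (α (i + 1)) < δ := by
  obtain ⟨q, c, hq, h0, hq', hc⟩ := hch (f^[n] u) u
  refine ⟨n + q, fun i => if i ≤ n then f^[i] u else c (i - n), by omega, by simp, by simp, ?_, ?_⟩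
  · have : ¬ (n + q ≤ n) := by omega
    simp only [this, if_false, Nat.add_sub_cancel_left, hq']
  · intro i hi
    rcases lt_trichotomy i n with h | h | h
    · have h1 : i ≤ n := h.le
      have h2 : i + 1 ≤ n := h
      simp only [h1, h2, if_true, ← Function.iterate_succ_apply' f, dist_self]
      exact hδ
    · subst h
      have := hc 0 (by omega)
      rw [h0] at this
      simpa using this
    · have h1 : ¬ i ≤ n := by omega
      have h2 : ¬ i + 1 ≤ n := by omega
      have h3 : i + 1 - n = (i - n) + 1 := by omega
      simp only [h1, h2, if_false, h3]
      exact hc _ (by omega)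

/-- Concatenation of two loops. -/
lemma concat_loops (f : X → X) (δ : ℝ) (u v : X) (huv : dist u v < δ / 2) (p q : ℕ)
    (α β : ℕ → X) (hp : 0 < p) (hq : 0 < q)
    (α0 : α 0 = u) (αp : α p = u) (hα : ∀ i < p, dist (f (α i)) (α (i + 1)) < δ / 2)
    (β0 : β 0 = v) (βq : β q = v) (hβ : ∀ i < q, dist (f (β i)) (β (i + 1)) < δ / 2) :
    let a : ℕ → X := fun i => if i < p then α i else β (i - p)
    (∀ i, i + 1 < p + q → dist (f (a i)) (a (i + 1)) < δ) ∧
    (∀ w, w = u ∨ w = v → dist (f (a (p + q - 1))) w < δ) := by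
  intro a
  have hpos : 0 < δ := by have := dist_nonneg (x := u) (y := v); linarith
  have hvu : dist v u < δ / 2 := by rwa [dist_comm]
  have tri : ∀ y s w : X, dist y s < δ / 2 → dist s w < δ / 2 → dist y w < δ := by
    intro y s w h1 h2
    have := dist_triangle y s w
    linarith
  constructor
  · intro i hi
    rcases lt_trichotomy (i + 1) p with h | h | h
    · have h1 : i < p := by omega
      simp only [a, h, h1, if_true]
      have := hα i h1
      linarith
    · have h1 : i < p := by omega
      have h2 : ¬ (i + 1 < p) := by omega
      have h3 : i + 1 - p = 0 := by omega
      simp only [a, h1, h2, h3, if_true, if_false, β0]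
      have := hα i h1
      rw [h, αp] at this
      exact tri _ _ _ this huv
    · have h1 : ¬ i < p := by omega
      have h2 : ¬ (i + 1 < p) := by omega
      have h3 : i + 1 - p = (i - p) + 1 := by omega
      simp only [a, h1, h2, h3, if_false]
      have := hβ (i - p) (by omega)
      linarith
  · intro w hw
    have h1 : ¬ p + q - 1 < p := by omega
    have h2 : p + q - 1 - p = q - 1 := by omega
    simp only [a, h1, h2, if_false]
    have := hβ (q - 1) (by omega)
    rw [show q - 1 + 1 = q by omega, βq] at this
    rcases hw with rfl | rfl
    · exact tri _ _ _ this hvu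
    · linarith

/-- Closed invariant sets with empty intersection, from a pair of separated loops. -/
lemma sets_of_loops [CompactSpace X] (f : X → X) (hf : Continuous f) (ε δ : ℝ)
    (hs : ∀ z : ℕ → X, (∀ n, dist (f (z n)) (z (n + 1)) < δ) →
      ∃ y : X, ∀ n, dist (f^[n] y) (z n) < ε)
    (N i : ℕ) (hi : i < N) (a b : ℕ → X) (hab : 2 * ε < dist (a i) (b i))
    (ha : ∀ r, r + 1 < N → dist (f (a r)) (a (r + 1)) < δ)
    (hb : ∀ r, r + 1 < N → dist (f (b r)) (b (r + 1)) < δ)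
    (haa : dist (f (a (N - 1))) (a 0) < δ) (hab' : dist (f (a (N - 1))) (b 0) < δ)
    (hba : dist (f (b (N - 1))) (a 0) < δ) (hbb : dist (f (b (N - 1))) (b 0) < δ) :
    ∃ W : ℕ → Set X, (∀ k, IsClosed (W k)) ∧ (∀ k, (W k).Nonempty) ∧
      (∀ k, MapsTo f (W k) (W k)) ∧ (∀ x, ∃ k, x ∉ W k) := by
  classical
  have hN : 0 < N := by omega
  let T : ℕ → ℕ → X := fun k n => if (k + 2) ∣ n then b i else a i
  let Z : ℕ → Set X := fun k =>
    {y | ∃ p, p < k + 2 ∧ ∀ n, dist (f^[n * N + i] y) (T k (n + p)) ≤ ε}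
  have hZclosed : ∀ k, IsClosed (Z k) := by
    intro k
    have : Z k = ⋃ p ∈ Finset.range (k + 2),
        ⋂ n, {y | dist (f^[n * N + i] y) (T k (n + p)) ≤ ε} := by
      ext y
      simp [Z]
    rw [this]
    refine isClosed_biUnion_finset fun p _ => isClosed_iInter fun n => ?_
    exact isClosed_le ((hf.iterate _).dist continuous_const) continuous_const
  have hZne : ∀ k, (Z k).Nonempty := by
    intro k
    obtain ⟨y, hy⟩ := hs (fun m => if (k + 2) ∣ (m / N) then b (m % N) else a (m % N)) (by
      intro m
      have hlt := Nat.mod_lt m hN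
      by_cases h : m % N + 1 < N
      · have h1 : (m + 1) % N = m % N + 1 := by
          rw [Nat.add_mod, Nat.mod_eq_of_lt (show 1 < N by omega), Nat.mod_eq_of_lt h]
        have h2 : (m + 1) / N = m / N := by
          rw [Nat.add_div hN]
          simp only [Nat.mod_eq_of_lt (show 1 < N by omega),
            Nat.div_eq_of_lt (show 1 < N by omega)]
          rw [if_neg (by omega)]
          omega
        simp only [h1, h2]
        split_ifs
        · exact hb _ h
        · exact ha _ h
      · have h0 : m % N = N - 1 := by omega
        have h1 : (m + 1) % N = 0 := by
          rw [← Nat.div_add_mod m N, h0, add_assoc, Nat.sub_add_cancel hN]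
          simp
        simp only [h1, h0]
        split_ifs <;> assumption)
    refine ⟨y, 0, by omega, fun n => ?_⟩
    have := hy (n * N + i)
    have h1 : (n * N + i) / N = n := by
      rw [add_comm, Nat.add_mul_div_right _ _ hN, Nat.div_eq_of_lt hi, zero_add]
    have h2 : (n * N + i) % N = i := by
      rw [add_comm, Nat.add_mul_mod_self_right, Nat.mod_eq_of_lt hi]
    simp only [h1, h2] at this
    exact this.le
  have hZinv : ∀ k y, y ∈ Z k → f^[N] y ∈ Z k := by
    rintro k y ⟨p, hp, hy⟩
    refine ⟨(p + 1) % (k + 2), Nat.mod_lt _ (by omega), fun n => ?_⟩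
    have := hy (n + 1)
    have h1 : T k (n + (p + 1) % (k + 2)) = T k (n + 1 + p) := by
      have : (k + 2) ∣ (n + (p + 1) % (k + 2)) ↔ (k + 2) ∣ (n + 1 + p) := by
        rw [Nat.dvd_iff_mod_eq_zero, Nat.dvd_iff_mod_eq_zero, Nat.add_mod_mod,
          show n + (p + 1) = n + 1 + p by ring]
      simp only [T, this]
    rw [h1, ← Function.iterate_add_apply, show n * N + i + N = (n + 1) * N + i by ring]
    exact this
  have hZdisj : ∀ j k y, j < k → y ∈ Z j → y ∈ Z k → False := by
    rintro j k y hjk ⟨p, hp, hy⟩ ⟨q, hq, hy'⟩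
    have hiff : ∀ n, (j + 2) ∣ (n + p) ↔ (k + 2) ∣ (n + q) := by
      intro n
      have h1 := hy n
      have h2 := hy' n
      have h3 := dist_triangle_left (T j (n + p)) (T k (n + q)) (f^[n * N + i] y)
      by_cases hA : (j + 2) ∣ (n + p) <;> by_cases hB : (k + 2) ∣ (n + q)
      · simp [hA, hB]
      · exfalso
        simp only [T, hA, hB, if_true, if_false] at h1 h2 h3
        rw [dist_comm (b i)] at h3
        linarith
      · exfalso
        simp only [T, hA, hB, if_true, if_false] at h1 h2 h3
        linarith
      · simp [hA, hB]
    have e1 : (j + 2) ∣ ((j + 2 - p) + p) := by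
      rw [Nat.sub_add_cancel hp.le]
    have e2 := (hiff _).1 e1
    have e3 : (j + 2) ∣ ((j + 2 - p + (j + 2)) + p) := by
      rw [show (j + 2 - p + (j + 2)) + p = (j + 2) + (j + 2) by omega]
      exact Dvd.intro_left 2 (by ring)
    have e4 := (hiff _).1 e3
    rw [show (j + 2 - p + (j + 2)) + q = (j + 2 - p + q) + (j + 2) by ring] at e4
    have e5 := (Nat.dvd_add_right e2).1 e4
    have := Nat.le_of_dvd (by omega) e5
    omega
  refine ⟨fun k => ⋃ r ∈ Finset.range N, f^[r] '' Z k, fun k => ?_, fun k => ?_, fun k => ?_, ?_⟩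
  · refine isClosed_biUnion_finset fun r _ => ?_
    exact ((hZclosed k).isCompact.image (hf.iterate r)).isClosed
  · obtain ⟨y, hy⟩ := hZne k
    refine ⟨y, ?_⟩
    simp only [mem_iUnion]
    exact ⟨0, by simpa using hN, y, hy, rfl⟩
  · intro y hy
    simp only [mem_iUnion] at hy ⊢
    obtain ⟨r, hr, w, hw, rfl⟩ := hy
    rw [Finset.mem_range] at hr
    by_cases h : r + 1 < N
    · exact ⟨r + 1, by simpa using h, w, hw, Function.iterate_succ_apply' f r w⟩
    · refine ⟨0, by simpa using hN, f^[N] w, hZinv k w hw, ?_⟩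
      rw [← Function.iterate_succ_apply' f, show r.succ = N by omega]
      rfl
  · intro x
    by_contra hcon
    push Not at hcon
    simp only [mem_iUnion] at hcon
    choose r hr w hw hwx using hcon
    obtain ⟨j, -, k, -, hjk, hrr⟩ := Finset.exists_ne_map_eq_of_card_lt_of_maps_to
      (s := Finset.range (N + 1)) (t := Finset.range N) (by simp) (f := r) (fun k _ => hr k)
    have key : ∀ l, f^[N - r l] x ∈ Z l := by
      intro l
      have h1 := Finset.mem_range.1 (hr l)
      have : f^[N - r l] x = f^[N] (w l) := by
        conv_lhs => rw [← hwx l]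
        rw [← Function.iterate_add_apply, Nat.sub_add_cancel h1.le]
      rw [this]
      exact hZinv l _ (hw l)
    have kj := key j
    have kk := key k
    rw [hrr] at kj
    rcases lt_or_gt_of_ne hjk with h | h
    · exact hZdisj j k _ h kj kk
    · exact hZdisj k j _ h kk kj

lemma exists_disjoint_sets [CompactSpace X] (f : X → X) (hf : Continuous f)
    (hsh : ShadowingProperty f)
    (hch : ∀ δ > 0, ∀ u v : X, ∃ (n : ℕ) (c : ℕ → X), 1 ≤ n ∧ c 0 = u ∧ c n = v ∧
      ∀ i < n, dist (f (c i)) (c (i + 1)) < δ)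
    (hne : ¬ ∀ ε > 0, ∃ δ > 0, ∀ u v : X, dist u v < δ → ∀ n, dist (f^[n] u) (f^[n] v) < ε) :
    ∃ W : ℕ → Set X, (∀ k, IsClosed (W k)) ∧ (∀ k, (W k).Nonempty) ∧
      (∀ k, MapsTo f (W k) (W k)) ∧ (∀ x, ∃ k, x ∉ W k) := by
  push Not at hne
  obtain ⟨ε, hε, hne⟩ := hne
  obtain ⟨δ, hδ, hs⟩ := hsh (ε / 3) (by positivity)
  obtain ⟨u, v, huv, n, hn⟩ := hne (δ / 2) (by positivity)
  obtain ⟨p, α, hp, α0, αn, αp, hα⟩ := exists_loop_s19 f (δ / 2) (by positivity)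
    (hch (δ / 2) (by positivity)) u n
  obtain ⟨q, β, hq, β0, βn, βq, hβ⟩ := exists_loop_s19 f (δ / 2) (by positivity)
    (hch (δ / 2) (by positivity)) v n
  obtain ⟨A1, A2⟩ := concat_loops f δ u v huv p q α β (by omega) (by omega) α0 αp hα β0 βq hβ
  obtain ⟨B1, B2⟩ := concat_loops f δ v u (by rwa [dist_comm]) q p β α (by omega) (by omega)
    β0 βq hβ α0 αp hα
  rw [add_comm q p] at B1 B2
  have hp0 : 0 < p := by omega
  have hq0 : 0 < q := by omega
  refine sets_of_loops f hf (ε / 3) δ hs (p + q) n (by omega)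
    (fun i => if i < p then α i else β (i - p)) (fun i => if i < q then β i else α (i - q))
    ?_ A1 B1 (A2 _ ?_) (A2 _ ?_) (B2 _ ?_) (B2 _ ?_)
  · simp only [hp, hq, if_true, αn, βn]
    linarith
  · left; simp [hp0, α0]
  · right; simp [hq0, β0]
  · right; simp [hp0, α0]
  · left; simp [hq0, β0]

lemma birkhoffAvg_continuous (f : X → X) (hf : Continuous f) (Φ : X → ℝ) (hΦ : Continuous Φ)
    (n : ℕ) : Continuous (birkhoffAvg f Φ n) := by
  unfold birkhoffAvg
  exact continuous_const.mul (continuous_finsetSum _ fun i _ => hΦ.comp (hf.iterate i))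

lemma exists_frequently_gt [CompactSpace X] [MeasurableSpace X] [BorelSpace X]
    (f : X → X) (hf : Continuous f) (Φ : X → ℝ) (hΦ : Continuous Φ)
    (μ : Measure X) [IsProbabilityMeasure μ] (hμ : MeasurePreserving f μ μ) (c : ℝ)
    (hc : c < ∫ x, Φ x ∂μ) : ∃ y, ∃ᶠ n in atTop, c < birkhoffAvg f Φ n y := by
  by_contra hcon
  push Not at hcon
  obtain ⟨C, hC⟩ := isCompact_univ.exists_bound_of_continuousOn hΦ.continuousOn
  have hC' : ∀ x, |Φ x| ≤ C := fun x => hC x (mem_univ x)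
  have hbd : ∀ n x, |birkhoffAvg f Φ n x| ≤ |C| := by
    intro n x
    unfold birkhoffAvg
    rcases Nat.eq_zero_or_pos n with rfl | hn
    · simp
    · have hn' : (0 : ℝ) < n := by exact_mod_cast hn
      rw [abs_mul, abs_of_pos (by positivity : (0 : ℝ) < 1 / n), one_div, inv_mul_le_iff₀ hn']
      refine (Finset.abs_sum_le_sum_abs _ _).trans ?_
      refine (Finset.sum_le_sum (fun i _ => (hC' (f^[i] x)).trans (le_abs_self C))).trans ?_
      simp
  have hintg : ∀ g : X → ℝ, Continuous g → Integrable g μ := by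
    intro g hg
    obtain ⟨D, hD⟩ := isCompact_univ.exists_bound_of_continuousOn hg.continuousOn
    exact Integrable.of_bound hg.aestronglyMeasurable D (Eventually.of_forall fun x => hD x (mem_univ x))
  have hI : ∀ n, 0 < n → ∫ x, birkhoffAvg f Φ n x ∂μ = ∫ x, Φ x ∂μ := by
    intro n hn
    have hn' : (n : ℝ) ≠ 0 := by exact_mod_cast hn.ne'
    unfold birkhoffAvg
    rw [integral_const_mul, integral_finsetSum _ (fun i _ => hintg (fun x => Φ (f^[i] x)) (hΦ.comp (hf.iterate i)))]
    have : ∀ i, ∫ x, Φ (f^[i] x) ∂μ = ∫ x, Φ x ∂μ := by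
      intro i
      have h := integral_map (μ := μ) (hf.iterate i).measurable.aemeasurable
        (hΦ.aestronglyMeasurable (μ := μ.map f^[i]))
      rw [(hμ.iterate i).map_eq] at h
      exact h.symm
    simp only [this, Finset.sum_const, Finset.card_range, nsmul_eq_mul]
    field_simp
  have hlim : Tendsto (fun n => ∫ x, max (birkhoffAvg f Φ n x) c ∂μ) atTop (𝓝 (∫ _x, c ∂μ)) := by
    refine tendsto_integral_of_dominated_convergence (fun _ => |C| + |c|) (fun n => ?_)
      (integrable_const _) (fun n => Eventually.of_forall fun x => ?_)
      (Eventually.of_forall fun x => ?_)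
    · exact ((birkhoffAvg_continuous f hf Φ hΦ n).max continuous_const).aestronglyMeasurable
    · rw [Real.norm_eq_abs]
      have := hbd n x
      refine (abs_max_le_max_abs_abs).trans (max_le ?_ ?_)
      · linarith [abs_nonneg c]
      · linarith [abs_nonneg C]
    · have := hcon x
      refine tendsto_const_nhds.congr' ?_
      filter_upwards [this] with n hn
      rw [max_eq_right hn]
  have hge : ∀ᶠ n in atTop, ∫ x, Φ x ∂μ ≤ ∫ x, max (birkhoffAvg f Φ n x) c ∂μ := by
    filter_upwards [eventually_gt_atTop 0] with n hn
    rw [← hI n hn]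
    have hcn := birkhoffAvg_continuous f hf Φ hΦ n
    exact integral_mono (hintg _ hcn) (hintg _ (hcn.max continuous_const))
      (fun x => le_max_left _ _)
  have := ge_of_tendsto hlim hge
  simp at this
  linarith

lemma dense_large_avg [CompactSpace X] [MeasurableSpace X] [BorelSpace X]
    (f : X → X) (hf : Continuous f) (hsh : ShadowingProperty f)
    (hch : ∀ δ > 0, ∀ u v : X, ∃ (n : ℕ) (c : ℕ → X), 1 ≤ n ∧ c 0 = u ∧ c n = v ∧
      ∀ i < n, dist (f (c i)) (c (i + 1)) < δ)
    (Φ : X → ℝ) (hΦ : Continuous Φ)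
    (μ : Measure X) [IsProbabilityMeasure μ] (hμ : MeasurePreserving f μ μ) (c : ℝ)
    (hc : c < ∫ x, Φ x ∂μ) (m : ℕ) :
    IsOpen {x | ∃ n, m ≤ n ∧ c < birkhoffAvg f Φ n x} ∧
    Dense {x | ∃ n, m ≤ n ∧ c < birkhoffAvg f Φ n x} := by
  constructor
  · have : {x | ∃ n, m ≤ n ∧ c < birkhoffAvg f Φ n x}
        = ⋃ n, ⋃ (_ : m ≤ n), {x | c < birkhoffAvg f Φ n x} := by
      ext x; simp
    rw [this]
    exact isOpen_iUnion fun n => isOpen_iUnion fun _ =>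
      isOpen_lt continuous_const (birkhoffAvg_continuous f hf Φ hΦ n)
  · obtain ⟨c', hcc', hc'⟩ := exists_between hc
    obtain ⟨y, hy⟩ := exists_frequently_gt f hf Φ hΦ μ hμ c' hc'
    obtain ⟨C, hC⟩ := isCompact_univ.exists_bound_of_continuousOn hΦ.continuousOn
    have hC' : ∀ x, |Φ x| ≤ C := fun x => hC x (mem_univ x)
    set κ := (c' - c) / 2 with hκ
    have hκ0 : 0 < κ := by rw [hκ]; linarith
    obtain ⟨ε₀, hε₀, huc⟩ := Metric.uniformContinuous_iff.1
      (CompactSpace.uniformContinuous_of_continuous hΦ) κ hκ0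
    rw [Metric.dense_iff]
    intro u η hη
    obtain ⟨δ, hδ, hs⟩ := hsh (min ε₀ η) (lt_min hε₀ hη)
    obtain ⟨l, ch, hl, h0, hl', hchain⟩ := hch δ hδ u y
    obtain ⟨x, hx⟩ := hs (fun i => if i < l then ch i else f^[i - l] y) (by
      intro i
      rcases lt_trichotomy (i + 1) l with h | h | h
      · have h1 : i < l := by omega
        simp only [h, h1, if_true]
        exact hchain i h1
      · have h1 : i < l := by omega
        have h2 : ¬ (i + 1 < l) := by omega
        have h3 : i + 1 - l = 0 := by omega
        simp only [h1, h2, h3, if_true, if_false, Function.iterate_zero, id]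
        rw [← hl', ← h]
        exact hchain i h1
      · have h1 : ¬ i < l := by omega
        have h2 : ¬ (i + 1 < l) := by omega
        have h3 : i + 1 - l = (i - l) + 1 := by omega
        simp only [h1, h2, h3, if_false, Function.iterate_succ_apply' f, dist_self]
        exact hδ)
    refine ⟨x, ?_, ?_⟩
    · have := hx 0
      have hl0 : 0 < l := hl
      simp only [hl0, if_true, h0, Function.iterate_zero, id] at this
      exact this.trans_le (min_le_right _ _)
    · obtain ⟨K, hK⟩ := exists_nat_gt ((l : ℝ) * (C + c) / κ)
      obtain ⟨n, hn, hgt⟩ := (frequently_atTop.1 hy) (max (max m 1) K)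
      have hnm : m ≤ n := (le_max_left m 1).trans ((le_max_left _ _).trans hn)
      have hn1 : 1 ≤ n := (le_max_right m 1).trans ((le_max_left _ _).trans hn)
      have hnK : K ≤ n := (le_max_right _ _).trans hn
      refine ⟨l + n, by omega, ?_⟩
      have hn' : (0 : ℝ) < n := by exact_mod_cast hn1
      have hln : (0 : ℝ) < ((l + n : ℕ) : ℝ) := by exact_mod_cast (by omega : 0 < l + n)
      unfold birkhoffAvg at hgt ⊢
      rw [one_div, lt_inv_mul_iff₀ hn'] at hgt
      rw [one_div, lt_inv_mul_iff₀ hln, Finset.sum_range_add]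
      have s1 : -(l * C) ≤ ∑ i ∈ Finset.range l, Φ (f^[i] x) := by
        have : ∑ i ∈ Finset.range l, (-C) ≤ ∑ i ∈ Finset.range l, Φ (f^[i] x) :=
          Finset.sum_le_sum fun i _ => (abs_le.1 (hC' _)).1
        simpa using this
      have s2 : ∑ i ∈ Finset.range n, Φ (f^[i] y) - n * κ
          ≤ ∑ i ∈ Finset.range n, Φ (f^[l + i] x) := by
        have : ∑ i ∈ Finset.range n, (Φ (f^[i] y) - κ) ≤ ∑ i ∈ Finset.range n, Φ (f^[l + i] x) := by
          refine Finset.sum_le_sum fun i _ => ?_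
          have h := hx (l + i)
          have h1 : ¬ (l + i < l) := by omega
          simp only [h1, if_false, Nat.add_sub_cancel_left] at h
          have h2 := huc (h.trans_le (min_le_left _ _))
          rw [Real.dist_eq] at h2
          have := (abs_lt.1 h2).1
          linarith
        simpa using this
      have s3 : (l : ℝ) * (C + c) < n * κ := by
        rw [div_lt_iff₀ hκ0] at hK
        have : (K : ℝ) ≤ n := by exact_mod_cast hnK
        nlinarith
      have s4 : n * c' = n * c + n * κ + n * κ := by rw [hκ]; ring
      push_cast
      linarith

lemma irregular_nonempty [CompactSpace X] [Nonempty X] [MeasurableSpace X] [BorelSpace X]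
    (f : X → X) (hf : Continuous f) (hsh : ShadowingProperty f)
    (hch : ∀ δ > 0, ∀ u v : X, ∃ (n : ℕ) (c : ℕ → X), 1 ≤ n ∧ c 0 = u ∧ c n = v ∧
      ∀ i < n, dist (f (c i)) (c (i + 1)) < δ)
    (Φ : X → ℝ) (hΦ : Continuous Φ)
    (μ ν : Measure X) [IsProbabilityMeasure μ] [IsProbabilityMeasure ν]
    (hμ : MeasurePreserving f μ μ) (hν : MeasurePreserving f ν ν)
    (hlt : ∫ x, Φ x ∂μ < ∫ x, Φ x ∂ν) : (IrregularSet f Φ).Nonempty := by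
  obtain ⟨c₁, h1, h1'⟩ := exists_between hlt
  obtain ⟨c₂, h2, h2'⟩ := exists_between h1'
  have hneg : ∀ n x, birkhoffAvg f (fun y => - Φ y) n x = - birkhoffAvg f Φ n x := by
    intro n x; simp [birkhoffAvg]
  have A := dense_large_avg f hf hsh hch Φ hΦ ν hν c₂ h2'
  have B := dense_large_avg f hf hsh hch (fun y => - Φ y) hΦ.neg μ hμ (-c₁)
    (by rw [integral_neg]; linarith)
  have hd := dense_iInter_of_isOpen_nat (f := fun m : ℕ => {x | ∃ n, m ≤ n ∧ c₂ < birkhoffAvg f Φ n x}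
      ∩ {x | ∃ n, m ≤ n ∧ -c₁ < birkhoffAvg f (fun y => - Φ y) n x})
    (fun m => (A m).1.inter (B m).1) (fun m => (A m).2.inter_of_isOpen_left (B m).2 (A m).1)
  obtain ⟨x, hx⟩ := hd.nonempty
  rw [mem_iInter] at hx
  refine ⟨x, ?_⟩
  rintro ⟨L, hL⟩
  have u1 : ∃ᶠ n in atTop, c₂ ≤ birkhoffAvg f Φ n x := by
    refine frequently_atTop.2 fun m => ?_
    obtain ⟨n, hn, h⟩ := (hx m).1
    exact ⟨n, hn, h.le⟩
  have u2 : ∃ᶠ n in atTop, birkhoffAvg f Φ n x ≤ c₁ := by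
    refine frequently_atTop.2 fun m => ?_
    obtain ⟨n, hn, h⟩ := (hx m).2
    rw [hneg] at h
    exact ⟨n, hn, by linarith⟩
  have v1 : c₂ ≤ L := ge_of_tendsto_of_frequently hL u1
  have v2 : L ≤ c₁ := le_of_tendsto_of_frequently hL u2
  linarith

/-- For a transitive map with shadowing and positive topological entropy, there is a continuous
`Φ` and distinct ergodic measures with distinct `Φ`-averages; the irregular set is nonempty
and `X` is the unique chain recurrent class. -/
theorem transitive_shadowing_positive_entropy [CompactSpace X]
    [MeasurableSpace X] [BorelSpace X]
    (f : X → X) (hf : Continuous f)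
    (htrans : ∃ x : X, Dense (Set.range fun n => f^[n] x))
    (hsh : ShadowingProperty f)
    (hent : 0 < bowenEntropy f (Set.univ : Set X)) :
    ∃ (Φ : X → ℝ) (μ₁ μ₂ : Measure X), Continuous Φ ∧
      IsProbabilityMeasure μ₁ ∧ IsProbabilityMeasure μ₂ ∧
      Ergodic f μ₁ ∧ Ergodic f μ₂ ∧ μ₁ ≠ μ₂ ∧
      (∫ x, Φ x ∂μ₁ ≠ ∫ x, Φ x ∂μ₂) ∧
      (IrregularSet f Φ).Nonempty ∧
      IsChainClass f (Set.univ : Set X) ∧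
      (∀ Y : Set X, IsChainClass f Y → Y = Set.univ) := by

  obtain ⟨x₀, hx₀⟩ := htrans
  have : Nonempty X := ⟨x₀⟩
  have hneq : ¬ ∀ ε > 0, ∃ δ > 0, ∀ u v : X, dist u v < δ →
      ∀ n, dist (f^[n] u) (f^[n] v) < ε := by
    intro h
    rw [entropy_zero_of_equicontinuous f h] at hent
    exact lt_irrefl _ hent
  have hrec : Dense (Set.range fun n => f^[n+1] x₀) := by
    by_contra h
    exact hneq (equicontinuous_of_not_recurrent f x₀ hx₀ hsh h)
  have hch : ∀ δ > 0, ∀ u v : X, ∃ (n : ℕ) (c : ℕ → X), 1 ≤ n ∧ c 0 = u ∧ c n = v ∧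
      ∀ i < n, dist (f (c i)) (c (i + 1)) < δ :=
    fun δ hδ u v => exists_chain_of_recurrent f hf x₀ hrec δ hδ u v
  have hstab : ∀ ε : ℝ, 0 < ε → ∀ u v : X, ChainStable f ε u v := by
    intro ε hε u v
    obtain ⟨n, c, hn, h0, hn', hc⟩ := hch ε hε u v
    exact ⟨n, c, fun _ => 1, hn, h0, hn', fun i hi => ⟨le_rfl, by simpa using hc i hi⟩⟩
  have hrel : ∀ u v : X, ChainRelated f u v := fun u v ε hε => ⟨hstab ε hε u v, hstab ε hε v u⟩
  have hclass : ∀ y, ChainClassOf f y = Set.univ := by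
    intro y
    refine eq_univ_of_forall fun z => ⟨hrel z z, hrel z y⟩
  obtain ⟨W, hWc, hWn, hWm, hWe⟩ := exists_disjoint_sets f hf hsh hch hneq
  choose μ hμp hμe hμW using fun k => kb_exists_ergodic_on f hf (W k) (hWc k) (hWn k) (hWm k)
  have hex : ∃ k, μ k ≠ μ 0 := by
    by_contra hcon
    push Not at hcon
    have h1 : μ 0 (⋃ k, (W k)ᶜ) = 0 := by
      refine measure_iUnion_null fun k => ?_
      rw [← hcon k]; exact hμW k
    have h2 : (⋃ k, (W k)ᶜ) = Set.univ := eq_univ_of_forall fun x => by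
      obtain ⟨k, hk⟩ := hWe x
      exact mem_iUnion.2 ⟨k, hk⟩
    have := hμp 0
    rw [h2, measure_univ] at h1
    exact one_ne_zero h1
  obtain ⟨k, hk⟩ := hex
  have := hμp k
  have := hμp 0
  have hΦ : ∃ Φ : BoundedContinuousFunction X ℝ, ∫ x, Φ x ∂(μ k) ≠ ∫ x, Φ x ∂(μ 0) := by
    by_contra hcon
    push Not at hcon
    exact hk (ext_of_forall_integral_eq_of_IsFiniteMeasure hcon)
  obtain ⟨Φ, hΦ⟩ := hΦ
  refine ⟨Φ, μ k, μ 0, Φ.continuous, hμp k, hμp 0, hμe k, hμe 0, hk, hΦ, ?_,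
    ⟨x₀, hrel _ _, (hclass x₀).symm⟩, ?_⟩
  · rcases lt_or_gt_of_ne hΦ with h | h
    · exact irregular_nonempty f hf hsh hch Φ Φ.continuous (μ k) (μ 0)
        (hμe k).toMeasurePreserving (hμe 0).toMeasurePreserving h
    · exact irregular_nonempty f hf hsh hch Φ Φ.continuous (μ 0) (μ k)
        (hμe 0).toMeasurePreserving (hμe k).toMeasurePreserving h
  · rintro Y ⟨y, -, rfl⟩
    exact hclass y
end
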